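/- Let p>1 and let ρ ∈ A be a maximizer of 𝒲_p over A. Then there exists x₀ ∈ ℝ^N such that the unique optimal plan π_ρ (between ρℒ^N and the unique optimal density η_ρℒ^N) is radial with center x₀: π_ρ({(x,y) ∈ ℝ^N×ℝ^N : ⟨y−x₀, x−x₀⟩ ≠ |y−x₀|·|x−x₀|}) = 0, i.e., π_ρ-almost every pair (x,y) has x and y on the same ray emanating from x₀. -/

import Mathlib

open MeasureTheory ENNReal Set Metric Filter

noncomputable section

/-- Euclidean space `ℝ^N`. -/
abbrev Euc (N : ℕ) := EuclideanSpace ℝ (Fin N)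

/-- The measure `ρ·γ` with density `ρ` with respect to `γ`. -/
def densM {α : Type*} [MeasurableSpace α] (γ : Measure α) (ρ : α → ℝ) : Measure α :=
  γ.withDensity fun x => ENNReal.ofReal (ρ x)

/-- `π` is a transport plan (coupling) with marginals `μ` and `ν`. -/
def IsCoupling {α : Type*} [MeasurableSpace α] (π : Measure (α × α)) (μ ν : Measure α) : Prop :=
  π.map Prod.fst = μ ∧ π.map Prod.snd = ν

/-- Transport cost `∬ d(x,y)^p dπ(x,y)`. -/
def tCost {α : Type*} [MeasurableSpace α] [Dist α] (p : ℝ) (π : Measure (α × α)) : ℝ≥0∞ :=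
  ∫⁻ z, ENNReal.ofReal (dist z.1 z.2 ^ p) ∂π

/-- The `p`-th power `W_p(μ,ν)^p` of the `p`-Wasserstein distance. -/
def WpPow {α : Type*} [MeasurableSpace α] [Dist α] (p : ℝ) (μ ν : Measure α) : ℝ≥0∞ :=
  ⨅ (π : Measure (α × α)) (_ : IsCoupling π μ ν), tCost p π

/-- The `p`-Wasserstein distance `W_p(μ,ν)`. -/
def Wp {α : Type*} [MeasurableSpace α] [Dist α] (p : ℝ) (μ ν : Measure α) : ℝ≥0∞ :=
  WpPow p μ ν ^ (1 / p)

/-- `ρ'` is an admissible competitor for the energy `𝒲_p(ρ)`: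
measurable, nonnegative, `ρ + ρ' ≤ 1` a.e., same total mass as `ρ`. -/
def Adm {α : Type*} [MeasurableSpace α] (γ : Measure α) (ρ ρ' : α → ℝ) : Prop :=
  Measurable ρ' ∧ (∀ x, 0 ≤ ρ' x) ∧ (∀ᵐ x ∂γ, ρ x + ρ' x ≤ 1) ∧
    ∫⁻ x, ENNReal.ofReal (ρ' x) ∂γ = ∫⁻ x, ENNReal.ofReal (ρ x) ∂γ

/-- The `p`-th power `𝒲_p(ρ)^p` of the Wasserstein energy of a density `ρ`. -/
def WEnergyPow {α : Type*} [MeasurableSpace α] [Dist α] (p : ℝ) (γ : Measure α) (ρ : α → ℝ) :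
    ℝ≥0∞ :=
  ⨅ (ρ' : α → ℝ) (_ : Adm γ ρ ρ'), WpPow p (densM γ ρ) (densM γ ρ')

/-- The Wasserstein energy `𝒲_p(ρ) = inf { W_p(ργ, ρ'γ) : ρ' admissible }`. -/
def WEnergy {α : Type*} [MeasurableSpace α] [Dist α] (p : ℝ) (γ : Measure α) (ρ : α → ℝ) :
    ℝ≥0∞ :=
  WEnergyPow p γ ρ ^ (1 / p)

/-- The class `A_m` of densities with values in `[0,1]` and total mass `m`. -/
def memA {α : Type*} [MeasurableSpace α] (γ : Measure α) (m : ℝ) (ρ : α → ℝ) : Prop :=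
  Measurable ρ ∧ (∀ᵐ x ∂γ, 0 ≤ ρ x ∧ ρ x ≤ 1) ∧ ∫ x, ρ x ∂γ = m

/-- The class `AP_ρ` of admissible plans: first marginal `ργ`, second marginal `≤ (1-ρ)γ`. -/
def AP {α : Type*} [MeasurableSpace α] (γ : Measure α) (ρ : α → ℝ) (π : Measure (α × α)) : Prop :=
  π.map Prod.fst = densM γ ρ ∧ π.map Prod.snd ≤ densM γ fun x => 1 - ρ x

/-- `z` belongs to the support of the measure `μ`. -/
def inSupport {α : Type*} [TopologicalSpace α] [MeasurableSpace α] (μ : Measure α) (z : α) :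
    Prop :=
  ∀ U : Set α, IsOpen U → z ∈ U → 0 < μ U

section Monotone

variable {E : Type*} [MetricSpace E]

lemma continuous_dist_rpow {p : ℝ} (hp : 0 ≤ p) :
    Continuous fun z : E × E => dist z.1 z.2 ^ p :=
  (continuous_fst.dist continuous_snd).rpow_const fun _ => Or.inr hp

variable [MeasurableSpace E]

lemma tCost_add (p : ℝ) (μ ν : Measure (E × E)) :
    tCost p (μ + ν) = tCost p μ + tCost p ν := lintegral_add_measure _ _ _

lemma tCost_smul (p : ℝ) (c : ℝ≥0∞) (μ : Measure (E × E)) :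
    tCost p (c • μ) = c * tCost p μ := lintegral_smul_measure _ _

lemma tCost_mono (p : ℝ) {μ ν : Measure (E × E)} (h : μ ≤ ν) : tCost p μ ≤ tCost p ν :=
  lintegral_mono' h le_rfl

variable [SecondCountableTopology E] [BorelSpace E]

lemma measurable_tCost_integrand (p : ℝ) :
    Measurable fun z : E × E => ENNReal.ofReal (dist z.1 z.2 ^ p) := by fun_prop

lemma tCost_map {α : Type*} [MeasurableSpace α] (p : ℝ) {μ : Measure α} {f : α → E × E}
    (hf : Measurable f) :
    tCost p (μ.map f) = ∫⁻ u, ENNReal.ofReal (dist (f u).1 (f u).2 ^ p) ∂μ :=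
  lintegral_map (measurable_tCost_integrand p) hf

/-- The support of a plan which is optimal for its own marginals is two-point monotone. -/
lemma monotone_support_of_optimal {p : ℝ} (hp : 0 ≤ p) {γ : Measure (E × E)} [IsFiniteMeasure γ]
    (hfin : tCost p γ ≠ ∞)
    (hmin : ∀ γ' : Measure (E × E), γ'.map Prod.fst = γ.map Prod.fst →
      γ'.map Prod.snd = γ.map Prod.snd → tCost p γ ≤ tCost p γ')
    {z w : E × E} (hz : z ∈ γ.support) (hw : w ∈ γ.support) :
    dist z.1 z.2 ^ p + dist w.1 w.2 ^ p ≤ dist z.1 w.2 ^ p + dist w.1 z.2 ^ p := by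
  by_contra! hlt
  let O : Set ((E × E) × (E × E)) := {u | dist u.1.1 u.2.2 ^ p + dist u.2.1 u.1.2 ^ p <
      dist u.1.1 u.1.2 ^ p + dist u.2.1 u.2.2 ^ p}
  have hc : ∀ f g : (E × E) × (E × E) → E, Continuous f → Continuous g →
      Continuous fun u => dist (f u) (g u) ^ p := fun f g hf hg =>
    (hf.dist hg).rpow_const fun _ => Or.inr hp
  have hO : IsOpen O := isOpen_lt
    ((hc _ _ (by fun_prop) (by fun_prop)).add (hc _ _ (by fun_prop) (by fun_prop)))
    ((hc _ _ (by fun_prop) (by fun_prop)).add (hc _ _ (by fun_prop) (by fun_prop)))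
  obtain ⟨U, V, hU, hV, hzU, hwV, hUV⟩ := isOpen_prod_iff.1 hO z w hlt
  set γ₀ := γ.restrict U
  set γ₁ := γ.restrict V
  have h₀ : 0 < γ U := Measure.mem_support_iff_forall z |>.1 hz U (hU.mem_nhds hzU)
  have h₁ : 0 < γ V := Measure.mem_support_iff_forall w |>.1 hw V (hV.mem_nhds hwV)
  set P := γ₀.prod γ₁ with hP
  set M := γ univ with hM
  have hM0 : M ≠ 0 := (h₀.trans_le (measure_mono (subset_univ _))).ne'
  have hMt : M ≠ ∞ := measure_ne_top _ _
  set s : ℝ≥0∞ := (2 * M)⁻¹ with hs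
  have hs0 : s ≠ 0 := by simp [hs, ENNReal.mul_eq_top, hMt]
  have hst : s ≠ ∞ := by simp [hs, hM0]
  have hsM : s * M = 2⁻¹ := by
    rw [hs, ENNReal.mul_inv (by simp) (by simp), mul_assoc, ENNReal.inv_mul_cancel hM0 hMt, mul_one]
  set α : Measure (E × E) := s • (P.map Prod.fst + P.map Prod.snd) with hα
  set β : Measure (E × E) := s • (P.map (fun u => (u.1.1, u.2.2)) +
    P.map (fun u => (u.2.1, u.1.2))) with hβ
  have half_le : ∀ (m : ℝ≥0∞) (W : Set (E × E)), m ≤ M →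
      s • (m • γ.restrict W) ≤ (2⁻¹ : ℝ≥0∞) • γ := by
    intro m W hm
    rw [smul_smul]
    refine Measure.le_iff.2 fun B _ => ?_
    simp only [Measure.smul_apply, smul_eq_mul]
    refine mul_le_mul' ?_ (Measure.restrict_apply_le _ _)
    rw [← hsM]; gcongr
  have hαγ : α ≤ γ := by
    rw [hα, hP, Measure.map_fst_prod, Measure.map_snd_prod, smul_add]
    calc _ ≤ (2⁻¹ : ℝ≥0∞) • γ + (2⁻¹ : ℝ≥0∞) • γ := by
          refine add_le_add (half_le _ _ ?_) (half_le _ _ ?_)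
          · exact Measure.restrict_apply_le _ _
          · exact Measure.restrict_apply_le _ _
      _ = γ := by rw [← add_smul, ENNReal.inv_two_add_inv_two, one_smul]
  have : IsFiniteMeasure α := isFiniteMeasure_of_le γ hαγ
  have hsub : γ - α + α = γ := Measure.sub_add_cancel_of_le hαγ
  have hfst : β.map Prod.fst = α.map Prod.fst := by
    simp only [hα, hβ, Measure.map_smul]
    rw [Measure.map_add _ _ measurable_fst, Measure.map_add _ _ measurable_fst]
    rw [Measure.map_map (by fun_prop) (by fun_prop), Measure.map_map (by fun_prop) (by fun_prop),
      Measure.map_map (by fun_prop) (by fun_prop), Measure.map_map (by fun_prop) (by fun_prop)]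
    rfl
  have hsnd : β.map Prod.snd = α.map Prod.snd := by
    simp only [hα, hβ, Measure.map_smul]
    rw [Measure.map_add _ _ measurable_snd, Measure.map_add _ _ measurable_snd]
    rw [Measure.map_map (by fun_prop) (by fun_prop), Measure.map_map (by fun_prop) (by fun_prop),
      Measure.map_map (by fun_prop) (by fun_prop), Measure.map_map (by fun_prop) (by fun_prop)]
    rw [add_comm]
    rfl
  have hcost : tCost p β < tCost p α := by
    have hα' : tCost p α = s * ∫⁻ u, (ENNReal.ofReal (dist u.1.1 u.1.2 ^ p) +
        ENNReal.ofReal (dist u.2.1 u.2.2 ^ p)) ∂P := by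
      rw [hα, tCost_smul, tCost_add, tCost_map p measurable_fst, tCost_map p measurable_snd,
        ← lintegral_add_left (by fun_prop)]
    have hβ' : tCost p β = s * ∫⁻ u, (ENNReal.ofReal (dist u.1.1 u.2.2 ^ p) +
        ENNReal.ofReal (dist u.2.1 u.1.2 ^ p)) ∂P := by
      rw [hβ, tCost_smul, tCost_add, tCost_map p (by fun_prop), tCost_map p (by fun_prop),
        ← lintegral_add_left (by fun_prop)]
    have hαt : tCost p α ≠ ∞ := ne_top_of_le_ne_top hfin (tCost_mono p hαγ)
    rw [hα'] at hαt ⊢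
    rw [hβ']
    refine (ENNReal.mul_lt_mul_iff_right hs0 hst).2 ?_
    have hae : ∀ᵐ u ∂P, u ∈ U ×ˢ V := by
      rw [hP, Measure.prod_restrict]
      exact ae_restrict_mem (hU.measurableSet.prod hV.measurableSet)
    have hlt' : ∀ᵐ u ∂P, ENNReal.ofReal (dist u.1.1 u.2.2 ^ p) +
        ENNReal.ofReal (dist u.2.1 u.1.2 ^ p) < ENNReal.ofReal (dist u.1.1 u.1.2 ^ p) +
        ENNReal.ofReal (dist u.2.1 u.2.2 ^ p) := by
      filter_upwards [hae] with u hu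
      have := hUV hu
      rw [← ENNReal.ofReal_add (by positivity) (by positivity),
        ← ENNReal.ofReal_add (by positivity) (by positivity)]
      have h0 : 0 ≤ dist u.1.1 u.2.2 ^ p + dist u.2.1 u.1.2 ^ p := by positivity
      exact (ENNReal.ofReal_lt_ofReal_iff (h0.trans_lt this)).2 this
    refine lintegral_strict_mono ?_ (by fun_prop) ?_ hlt'
    · intro h
      have := congrArg (fun m : Measure _ => m (U ×ˢ V)) h
      simp [hP, Measure.prod_prod, γ₀, γ₁, h₀.ne', h₁.ne'] at this
    · refine ne_top_of_le_ne_top (ENNReal.lt_top_of_mul_ne_top_right hαt hs0).ne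
        (lintegral_mono_ae (hlt'.mono fun _ h => h.le))
  have key := hmin (γ - α + β) (by
      conv_rhs => rw [← hsub]
      rw [Measure.map_add _ _ measurable_fst, Measure.map_add _ _ measurable_fst, hfst]) (by
      conv_rhs => rw [← hsub]
      rw [Measure.map_add _ _ measurable_snd, Measure.map_add _ _ measurable_snd, hsnd])
  conv_lhs at key => rw [← hsub]
  rw [tCost_add, tCost_add] at key
  have hft : tCost p (γ - α) ≠ ∞ := ne_top_of_le_ne_top hfin (tCost_mono p Measure.sub_le)
  exact absurd ((ENNReal.add_le_add_iff_left hft).1 key) hcost.not_ge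

end Monotone

section Graph

variable {E : Type*} [NormedAddCommGroup E] [InnerProductSpace ℝ E]

lemma convexOn_norm_rpow {p : ℝ} (hp : 1 ≤ p) : ConvexOn ℝ univ fun x : E => ‖x‖ ^ p := by
  refine ⟨convex_univ, fun x _ y _ a b ha hb hab => ?_⟩
  calc ‖a • x + b • y‖ ^ p ≤ (a * ‖x‖ + b * ‖y‖) ^ p := by
        refine Real.rpow_le_rpow (norm_nonneg _) ((norm_add_le _ _).trans ?_) (by linarith)
        rw [norm_smul, norm_smul, Real.norm_of_nonneg ha, Real.norm_of_nonneg hb]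
    _ ≤ a * ‖x‖ ^ p + b * ‖y‖ ^ p :=
        (convexOn_rpow hp).2 (norm_nonneg x) (norm_nonneg y) ha hb hab

lemma norm_midpoint_rpow_lt {p : ℝ} (hp : 1 < p) {a b : E} (hab : a ≠ b) :
    2 * ‖(2⁻¹ : ℝ) • (a + b)‖ ^ p < ‖a‖ ^ p + ‖b‖ ^ p := by
  have h2 : ‖(2⁻¹ : ℝ) • (a + b)‖ = 2⁻¹ * ‖a + b‖ := by
    rw [norm_smul, Real.norm_of_nonneg (by norm_num)]
  by_cases hn : ‖a‖ = ‖b‖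
  · have hlt : ‖(2⁻¹ : ℝ) • (a + b)‖ < ‖b‖ := by
      have := norm_add_lt_of_not_sameRay (fun h => hab (h.norm_eq_iff.1 hn))
      rw [h2]; linarith
    have := Real.rpow_lt_rpow (norm_nonneg _) hlt (by linarith : 0 < p)
    rw [hn]; linarith
  · have hle : ‖(2⁻¹ : ℝ) • (a + b)‖ ≤ 2⁻¹ * ‖a‖ + 2⁻¹ * ‖b‖ := by
      rw [h2]; linarith [norm_add_le a b]
    have h := Real.rpow_le_rpow (norm_nonneg _) hle (by linarith : 0 ≤ p)
    have h' := (strictConvexOn_rpow hp).2 (norm_nonneg a) (norm_nonneg b) hn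
      (by norm_num : (0 : ℝ) < 2⁻¹) (by norm_num : (0 : ℝ) < 2⁻¹) (by norm_num)
    simp only [smul_eq_mul] at h'
    linarith

/-- Moving the first point towards the second one by a small amount gains as soon as moving it
half-way does. -/
lemma norm_rpow_shift_lt {p : ℝ} (hp : 1 ≤ p) {a b v : E}
    (h : ‖a - (2⁻¹ : ℝ) • v‖ ^ p + ‖b + (2⁻¹ : ℝ) • v‖ ^ p < ‖a‖ ^ p + ‖b‖ ^ p)
    {t : ℝ} (ht : 0 < t) (ht2 : t ≤ 2⁻¹) :
    ‖a - t • v‖ ^ p + ‖b‖ ^ p < ‖a‖ ^ p + ‖b - t • v‖ ^ p := by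
  have h1 := (convexOn_norm_rpow (E := E) hp).2 (mem_univ a) (mem_univ (a - (2⁻¹ : ℝ) • v))
    (by linarith : 0 ≤ 1 - 2 * t) (by linarith : 0 ≤ 2 * t) (by ring)
  have e1 : (1 - 2 * t) • a + (2 * t) • (a - (2⁻¹ : ℝ) • v) = a - t • v := by module
  have hpos : 0 < 1 + 2 * t := by linarith
  have h2 := (convexOn_norm_rpow (E := E) hp).2 (mem_univ (b - t • v))
    (mem_univ (b + (2⁻¹ : ℝ) • v)) (by positivity : 0 ≤ (1 + 2 * t)⁻¹)
    (by positivity : 0 ≤ 2 * t * (1 + 2 * t)⁻¹) (by field_simp)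
  have e2 : (1 + 2 * t)⁻¹ • (b - t • v) + (2 * t * (1 + 2 * t)⁻¹) • (b + (2⁻¹ : ℝ) • v) = b := by
    have : (1 + 2 * t)⁻¹ • (b - t • v) + (2 * t * (1 + 2 * t)⁻¹) • (b + (2⁻¹ : ℝ) • v)
      = ((1 + 2 * t)⁻¹ * (1 + 2 * t)) • b := by module
    rw [this, inv_mul_cancel₀ hpos.ne', one_smul]
  rw [e1] at h1
  rw [e2] at h2
  simp only [smul_eq_mul] at h1 h2
  have h3 : (1 + 2 * t) * ‖b‖ ^ p ≤ ‖b - t • v‖ ^ p + 2 * t * ‖b + (2⁻¹ : ℝ) • v‖ ^ p := by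
    calc _ ≤ (1 + 2 * t) * ((1 + 2 * t)⁻¹ * ‖b - t • v‖ ^ p +
        2 * t * (1 + 2 * t)⁻¹ * ‖b + (2⁻¹ : ℝ) • v‖ ^ p) := by gcongr
      _ = _ := by field_simp
  nlinarith [mul_lt_mul_of_pos_left h (by linarith : 0 < 2 * t)]

variable [FiniteDimensional ℝ E] [MeasurableSpace E] [BorelSpace E]

/-- A closed two-point monotone set is a graph over the complement of a null set. -/
lemma volume_multivalued_eq_zero {p : ℝ} (hp : 1 < p) {S : Set (E × E)} (hS : IsClosed S)
    (hmono : ∀ z ∈ S, ∀ w ∈ S,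
      dist z.1 z.2 ^ p + dist w.1 w.2 ^ p ≤ dist z.1 w.2 ^ p + dist w.1 z.2 ^ p) :
    volume {x : E | ∃ y y', y ≠ y' ∧ (x, y) ∈ S ∧ (x, y') ∈ S} = 0 := by
  let T : Set (E × E × E) := {τ | (τ.1, τ.2.1) ∈ S ∧ (τ.1, τ.2.2) ∈ S}
  have hT : IsClosed T := (hS.preimage (f := fun τ : E × E × E => (τ.1, τ.2.1)) (by fun_prop)).inter
    (hS.preimage (f := fun τ : E × E × E => (τ.1, τ.2.2)) (by fun_prop))
  let T' : Set (E × E × E) := {τ ∈ T | τ.2.1 ≠ τ.2.2}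
  let m : OuterMeasure (E × E × E) := OuterMeasure.comap Prod.fst volume.toOuterMeasure
  have hnull : m T' = 0 := by
    refine measure_null_of_locally_null T' fun τ hτ => ?_
    obtain ⟨x₀, y₀, y₁⟩ := τ
    have hne : y₀ ≠ y₁ := hτ.2
    set v := y₁ - y₀ with hv
    let G : Set (E × E × E) := {τ | ‖τ.1 - τ.2.1 - (2⁻¹ : ℝ) • v‖ ^ p +
      ‖τ.1 - τ.2.2 + (2⁻¹ : ℝ) • v‖ ^ p < ‖τ.1 - τ.2.1‖ ^ p + ‖τ.1 - τ.2.2‖ ^ p}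
    have hc : ∀ f : E × E × E → E, Continuous f → Continuous fun τ => ‖f τ‖ ^ p :=
      fun f hf => hf.norm.rpow_const fun _ => Or.inr (by linarith)
    have hG : IsOpen G := isOpen_lt
      ((hc _ (by fun_prop)).add (hc _ (by fun_prop)))
      ((hc _ (by fun_prop)).add (hc _ (by fun_prop)))
    have hmem : (x₀, y₀, y₁) ∈ G := by
      have h := norm_midpoint_rpow_lt hp (a := x₀ - y₀) (b := x₀ - y₁)
        (fun h => hne (sub_right_injective h))
      have e1 : x₀ - y₀ - (2⁻¹ : ℝ) • v = (2⁻¹ : ℝ) • (x₀ - y₀ + (x₀ - y₁)) := by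
        rw [hv]; module
      have e2 : x₀ - y₁ + (2⁻¹ : ℝ) • v = (2⁻¹ : ℝ) • (x₀ - y₀ + (x₀ - y₁)) := by
        rw [hv]; module
      change ‖x₀ - y₀ - (2⁻¹ : ℝ) • v‖ ^ p + ‖x₀ - y₁ + (2⁻¹ : ℝ) • v‖ ^ p < _
      rw [e1, e2]; linarith
    obtain ⟨r, hr, hrG⟩ := nhds_basis_closedBall.mem_iff.1 (hG.mem_nhds hmem)
    refine ⟨closedBall (x₀, y₀, y₁) r ∩ T', inter_mem (mem_nhdsWithin_of_mem_nhds
      (closedBall_mem_nhds _ hr)) self_mem_nhdsWithin, ?_⟩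
    set K := closedBall (x₀, y₀, y₁) r ∩ T
    have hK : IsCompact K := (isCompact_closedBall _ _).inter_right hT
    have hD : IsCompact (Prod.fst '' K) := hK.image continuous_fst
    have hzero : volume (Prod.fst '' K) = 0 := by
      by_contra hne0
      have hst := Measure.sub_mem_nhds_zero_of_addHaar_pos volume (Prod.fst '' K)
        hD.measurableSet (pos_iff_ne_zero.2 hne0)
      have hlim : Tendsto (fun t : ℝ => t • v) (nhdsWithin 0 (Ioi 0)) (nhds 0) := by
        have : Tendsto (fun t : ℝ => t • v) (nhds 0) (nhds ((0 : ℝ) • v)) :=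
          Continuous.tendsto (by fun_prop) 0
        rw [zero_smul] at this
        exact this.mono_left nhdsWithin_le_nhds
      obtain ⟨t, hts, ht0, ht2⟩ := ((hlim.eventually hst).and
        (Ioc_mem_nhdsGT (by norm_num : (0 : ℝ) < 2⁻¹))).exists
      obtain ⟨x, ⟨⟨x, y, y'⟩, ⟨hb, hxT⟩, rfl⟩, x', ⟨⟨x', z, z'⟩, ⟨hb', hxT'⟩, rfl⟩, hxx⟩ := hts
      have hxx : x - x' = t • v := hxx
      have hmix : (x, y, z') ∈ G := by
        refine hrG ?_
        simp only [mem_closedBall, Prod.dist_eq, max_le_iff] at hb hb' ⊢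
        exact ⟨hb.1, hb.2.1, hb'.2.2⟩
      have hs := norm_rpow_shift_lt hp.le hmix ht0 ht2
      have hm := hmono (x, y) hxT.1 (x', z') hxT'.2
      simp only [dist_eq_norm] at hm
      have e : x' = x - t • v := by rw [← hxx]; abel
      have e1 : x' - z' = x - z' - t • v := by rw [e]; abel
      have e2 : x' - y = x - y - t • v := by rw [e]; abel
      rw [e1, e2] at hm
      simp only at hs
      linarith
    refine measure_mono_null (fun τ hτ => ?_) (?_ : m K = 0)
    · exact ⟨hτ.1, hτ.2.1⟩
    · simpa [m, OuterMeasure.comap_apply] using hzero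
  have : {x : E | ∃ y y', y ≠ y' ∧ (x, y) ∈ S ∧ (x, y') ∈ S} = Prod.fst '' T' := by
    ext x
    constructor
    · rintro ⟨y, y', hne, h, h'⟩
      exact ⟨(x, y, y'), ⟨⟨h, h'⟩, hne⟩, rfl⟩
    · rintro ⟨⟨x, y, y'⟩, ⟨⟨h, h'⟩, hne⟩, rfl⟩
      exact ⟨y, y', hne, h, h'⟩
  rw [this]
  simpa [m, OuterMeasure.comap_apply] using hnull

/-- Two plans with the same absolutely continuous first marginal, whose sum is optimal for its
marginals, are concentrated on the same closed sets. -/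
lemma concentrated_of_sum_optimal {p : ℝ} (hp : 1 < p) {π π' : Measure (E × E)}
    [IsFiniteMeasure π] [IsFiniteMeasure π'] (hac : π.map Prod.fst ≪ volume)
    (hfst : π'.map Prod.fst = π.map Prod.fst) (hfin : tCost p (π + π') ≠ ∞)
    (hmin : ∀ γ' : Measure (E × E), γ'.map Prod.fst = (π + π').map Prod.fst →
      γ'.map Prod.snd = (π + π').map Prod.snd → tCost p (π + π') ≤ tCost p γ')
    {F : Set (E × E)} (hF : IsClosed F) (hπ' : ∀ᵐ z ∂π', z ∈ F) : ∀ᵐ z ∂π, z ∈ F := by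
  set S := (π + π').support with hS
  have hnull := volume_multivalued_eq_zero hp (S := S) Measure.isClosed_support
    fun z hz w hw => monotone_support_of_optimal (by linarith) hfin hmin hz hw
  have hsupp : ∀ᵐ z ∂(π + π'), z ∈ S := Measure.support_mem_ae
  rw [ae_add_measure_iff] at hsupp
  have hA : MeasurableSet (Prod.fst '' (S ∩ F)) := by
    obtain ⟨K, hK, hKe⟩ := (isSigmaCompact_univ.of_isClosed_subset
      (Measure.isClosed_support.inter hF) (subset_univ (S ∩ F))).image
      (continuous_fst (X := E) (Y := E))
    rw [← hKe]
    exact MeasurableSet.iUnion fun n => (hK n).measurableSet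
  have h1 : ∀ᵐ x ∂(π.map Prod.fst), x ∈ Prod.fst '' (S ∩ F) := by
    rw [← hfst]
    refine (ae_map_iff measurable_fst.aemeasurable hA).2 ?_
    filter_upwards [hsupp.2, hπ'] with z hz hzF
    exact ⟨z, ⟨hz, hzF⟩, rfl⟩
  have h2 : ∀ᵐ x ∂(π.map Prod.fst), ¬ ∃ y y', y ≠ y' ∧ (x, y) ∈ S ∧ (x, y') ∈ S :=
    hac (by rw [compl_ofPred]; simpa using hnull)
  filter_upwards [ae_of_ae_map measurable_fst.aemeasurable h1,
    ae_of_ae_map measurable_fst.aemeasurable h2, hsupp.1] with z hz1 hz2 hzS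
  obtain ⟨⟨x, y⟩, ⟨hwS, hwF⟩, hw⟩ := hz1
  have hw : x = z.1 := hw
  subst hw
  by_cases hy : y = z.2
  · subst hy; exact hwF
  · exact absurd ⟨y, z.2, hy, hwS, hzS⟩ hz2

end Graph

section PlanEnergy

/-- The least cost of an admissible plan, computed directly over plans. -/
def planE {α : Type*} [MeasureSpace α] [Dist α] (p : ℝ) (ρ : α → ℝ) : ℝ≥0∞ :=
  ⨅ (π : Measure (α × α)) (_ : AP volume ρ π), tCost p π

section General

variable {α : Type*} [MeasureSpace α] {ρ : α → ℝ}

lemma planE_le [Dist α] {p : ℝ} {π : Measure (α × α)} (h : AP volume ρ π) :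
    planE p ρ ≤ tCost p π := iInf₂_le π h

lemma lintegral_of_memA (h : memA (volume : Measure α) 1 ρ) :
    ∫⁻ x, ENNReal.ofReal (ρ x) = 1 := by
  have hi : Integrable ρ := by
    by_contra hn
    have := h.2.2
    rw [integral_undef hn] at this
    norm_num at this
  rw [← ofReal_integral_eq_lintegral_ofReal hi (h.2.1.mono fun x hx => hx.1), h.2.2,
    ENNReal.ofReal_one]

lemma memA_of_lintegral (hm : Measurable ρ) (h01 : ∀ᵐ x, 0 ≤ ρ x ∧ ρ x ≤ 1)
    (h : ∫⁻ x, ENNReal.ofReal (ρ x) = 1) : memA (volume : Measure α) 1 ρ := by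
  refine ⟨hm, h01, ?_⟩
  rw [integral_eq_lintegral_of_nonneg_ae (h01.mono fun x hx => hx.1) hm.aestronglyMeasurable, h,
    ENNReal.toReal_one]

lemma densM_univ (h : memA (volume : Measure α) 1 ρ) : densM volume ρ univ = 1 := by
  rw [densM, withDensity_apply _ MeasurableSet.univ, setLIntegral_univ, lintegral_of_memA h]

lemma densM_le_volume {ρ : α → ℝ} (h : ∀ᵐ x, ρ x ≤ 1) : densM volume ρ ≤ volume := by
  calc densM volume ρ ≤ (volume : Measure α).withDensity 1 := by
        refine withDensity_mono ?_
        filter_upwards [h] with x hx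
        simpa using hx
    _ = volume := withDensity_one

lemma densM_ac (ρ : α → ℝ) : densM volume ρ ≪ volume := withDensity_absolutelyContinuous _ _

lemma isProbabilityMeasure_of_AP (h : memA (volume : Measure α) 1 ρ) {π : Measure (α × α)}
    (hπ : AP volume ρ π) : IsProbabilityMeasure π := by
  constructor
  have := congrArg (fun m => m univ) hπ.1
  simpa [Measure.map_apply measurable_fst MeasurableSet.univ, densM_univ h] using this

lemma WEnergyPow_eq_planE [Dist α] [SigmaFinite (volume : Measure α)] (p : ℝ)
    (h : memA (volume : Measure α) 1 ρ) : WEnergyPow p volume ρ = planE p ρ := by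
  apply le_antisymm
  · refine le_iInf₂ fun π hπ => ?_
    have := isProbabilityMeasure_of_AP h hπ
    set ν := π.map Prod.snd with hν
    have hνac : ν ≪ volume := (Measure.absolutelyContinuous_of_le hπ.2).trans (densM_ac _)
    have hνp : IsProbabilityMeasure ν :=
      Measure.isProbabilityMeasure_map measurable_snd.aemeasurable
    let η : α → ℝ := fun x => (ν.rnDeriv volume x).toReal
    have hη : densM volume η = ν := by
      rw [← Measure.withDensity_rnDeriv_eq ν volume hνac, densM]
      refine withDensity_congr_ae ?_
      filter_upwards [Measure.rnDeriv_lt_top ν (volume : Measure α)] with x hx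
      exact ENNReal.ofReal_toReal hx.ne
    have hηm : Measurable η := (Measure.measurable_rnDeriv _ _).ennreal_toReal
    have hle : ∀ᵐ x : α, ENNReal.ofReal (η x) ≤ ENNReal.ofReal (1 - ρ x) := by
      refine ae_le_of_forall_setLIntegral_le_of_sigmaFinite hηm.ennreal_ofReal
        fun s hs _ => ?_
      have := hπ.2 s
      rw [← hν, ← hη] at this
      rwa [densM, densM, withDensity_apply _ hs, withDensity_apply _ hs] at this
    have hadm : Adm volume ρ η := by
      refine ⟨hηm, fun x => ENNReal.toReal_nonneg, ?_, ?_⟩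
      · filter_upwards [hle, h.2.1] with x hx h1
        have := (ENNReal.ofReal_le_ofReal_iff (by linarith)).1 hx
        linarith
      · rw [lintegral_of_memA h]
        have := hνp.measure_univ
        rwa [← hη, densM, withDensity_apply _ MeasurableSet.univ, setLIntegral_univ] at this
    refine (iInf₂_le η hadm).trans (iInf₂_le π ⟨hπ.1, ?_⟩)
    rw [hη]
  · refine le_iInf₂ fun η hη => le_iInf₂ fun π hπ => planE_le ⟨hπ.1, ?_⟩
    rw [hπ.2]
    refine withDensity_mono ?_
    filter_upwards [hη.2.2.1] with x hx
    exact ENNReal.ofReal_le_ofReal (by linarith)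

end General

variable {E : Type*} [NormedAddCommGroup E] [InnerProductSpace ℝ E] [FiniteDimensional ℝ E]
  [MeasurableSpace E] [BorelSpace E] {ρ : E → ℝ}

lemma isTightMeasureSet_of_tCost_le {p : ℝ} (hp : 1 < p) {μ : Measure E} [IsFiniteMeasure μ]
    {C : ℝ≥0∞} (hC : C ≠ ∞) :
    IsTightMeasureSet {π : Measure (E × E) | π.map Prod.fst = μ ∧ tCost p π ≤ C} := by
  rw [isTightMeasureSet_iff_exists_isCompact_measure_compl_le]
  intro ε hε
  have hε2 : 0 < ε / 2 := ENNReal.half_pos hε.ne'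
  obtain ⟨K₁, hK₁, hK₁μ⟩ := isTightMeasureSet_iff_exists_isCompact_measure_compl_le.1
    (isTightMeasureSet_singleton (μ := μ)) (ε / 2) hε2
  have hK₁μ := hK₁μ μ rfl
  obtain ⟨r, hr⟩ := hK₁.isBounded.subset_closedBall 0
  obtain ⟨R, hR0, hR⟩ : ∃ R : ℝ, 0 < R ∧ C / ENNReal.ofReal (R ^ p) ≤ ε / 2 := by
    by_cases hεt : ε = ∞
    · exact ⟨1, one_pos, by simp [hεt, ENNReal.top_div]⟩
    have h1 : Tendsto (fun R : ℝ => ENNReal.ofReal (R ^ p)) atTop (nhds ∞) :=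
      tendsto_ofReal_nhds_top.2 (tendsto_rpow_atTop (by linarith))
    have h2 : Tendsto (fun R : ℝ => C / ENNReal.ofReal (R ^ p)) atTop (nhds 0) := by
      have := ENNReal.Tendsto.const_div (a := C) h1 (Or.inr hC)
      simpa using this
    obtain ⟨R, hR, hR0⟩ := ((h2.eventually (gt_mem_nhds hε2)).and (eventually_gt_atTop 0)).exists
    exact ⟨R, hR0, hR.le⟩
  refine ⟨closedBall 0 r ×ˢ closedBall 0 (r + R),
    (isCompact_closedBall _ _).prod (isCompact_closedBall _ _), ?_⟩
  rintro π ⟨hπ, hcost⟩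
  have hsub : (closedBall (0 : E) r ×ˢ closedBall (0 : E) (r + R))ᶜ ⊆
      Prod.fst ⁻¹' K₁ᶜ ∪ {z : E × E | ENNReal.ofReal (R ^ p) ≤ ENNReal.ofReal (dist z.1 z.2 ^ p)} := by
    rintro ⟨x, y⟩ hz
    by_cases hx : x ∈ K₁
    · right
      have hx' := mem_closedBall_zero_iff.1 (hr hx)
      have hy : r + R < ‖y‖ := by
        by_contra! hy
        exact hz ⟨hr hx, mem_closedBall_zero_iff.2 hy⟩
      refine ENNReal.ofReal_le_ofReal (Real.rpow_le_rpow hR0.le ?_ (by linarith))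
      have := norm_sub_norm_le y x
      rw [dist_comm, dist_eq_norm]
      show R ≤ ‖y - x‖
      linarith
    · exact Or.inl hx
  calc π _ ≤ π (Prod.fst ⁻¹' K₁ᶜ) + π {z : E × E | ENNReal.ofReal (R ^ p) ≤
        ENNReal.ofReal (dist z.1 z.2 ^ p)} := (measure_mono hsub).trans (measure_union_le _ _)
    _ ≤ ε / 2 + ε / 2 := by
      gcongr
      · rwa [← Measure.map_apply measurable_fst hK₁.measurableSet.compl, hπ]
      · refine (meas_ge_le_lintegral_div (measurable_tCost_integrand p).aemeasurable ?_ ?_).trans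
          ((ENNReal.div_le_div_right hcost _).trans hR)
        · simpa using Real.rpow_pos_of_pos hR0 p
        · simp
    _ = ε := ENNReal.add_halves ε

lemma exists_AP_tCost_eq {p : ℝ} (hp : 1 < p) (h : memA volume 1 ρ) (hfin : planE p ρ ≠ ∞) :
    ∃ π, AP volume ρ π ∧ tCost p π = planE p ρ := by
  obtain ⟨u, -, hu, hulim⟩ := exists_seq_strictAnti_tendsto' (ENNReal.lt_add_right hfin one_ne_zero)
  have hex : ∀ n, ∃ π, AP volume ρ π ∧ tCost p π < u n := fun n => by
    have := (hu n).1
    simpa only [planE, iInf_lt_iff, exists_prop] using this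
  choose π hπ hcost using hex
  have hprob : ∀ n, IsProbabilityMeasure (π n) := fun n => isProbabilityMeasure_of_AP h (hπ n)
  let P : ℕ → ProbabilityMeasure (E × E) := fun n => ⟨π n, hprob n⟩
  have hμf : IsFiniteMeasure (densM volume ρ) := ⟨by simp [densM_univ h]⟩
  have htight : IsTightMeasureSet {((μ : ProbabilityMeasure (E × E)) : Measure (E × E)) |
      μ ∈ range P} := by
    refine (isTightMeasureSet_of_tCost_le hp (μ := densM volume ρ) (C := planE p ρ + 1)
      (ENNReal.add_ne_top.2 ⟨hfin, one_ne_top⟩)).subset ?_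
    rintro _ ⟨_, ⟨n, rfl⟩, rfl⟩
    exact ⟨(hπ n).1, (hcost n).le.trans (hu n).2.le⟩
  obtain ⟨Q, -, φ, hφ, hlim⟩ := (isCompact_closure_of_isTightMeasureSet htight).isSeqCompact
    (x := P) fun n => subset_closure ⟨n, rfl⟩
  have hopen : ∀ G, IsOpen G → (Q : Measure (E × E)) G ≤
      atTop.liminf fun n => π (φ n) G := fun G hG =>
    ProbabilityMeasure.le_liminf_measure_open_of_tendsto hlim hG
  have hcostQ : tCost p (Q : Measure (E × E)) ≤ planE p ρ := by
    refine (lintegral_le_liminf_lintegral_of_forall_isOpen_measure_le_liminf_measure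
      (continuous_dist_rpow (by linarith : 0 ≤ p))
      (fun z => Real.rpow_nonneg dist_nonneg _) hopen).trans ?_
    have hl : Tendsto (fun n => u (φ n)) atTop (nhds (planE p ρ)) :=
      hulim.comp hφ.tendsto_atTop
    rw [← hl.liminf_eq]
    exact liminf_le_liminf (Eventually.of_forall fun n => (hcost (φ n)).le)
  have hfst : (Q : Measure (E × E)).map Prod.fst = densM volume ρ := by
    have h1 := ProbabilityMeasure.tendsto_map_of_tendsto_of_continuous _ Q hlim
      (continuous_fst (X := E) (Y := E))
    let M : ProbabilityMeasure E := ⟨densM volume ρ, ⟨densM_univ h⟩⟩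
    have h2 : ∀ n, ((P ∘ φ) n).map (continuous_fst (X := E) (Y := E)).measurable.aemeasurable = M :=
      fun n => Subtype.ext (hπ (φ n)).1
    have h3 := tendsto_nhds_unique h1 (tendsto_const_nhds.congr fun n => (h2 n).symm)
    exact congrArg Subtype.val h3
  have hAP : AP volume ρ (Q : Measure (E × E)) := by
    refine ⟨hfst, ?_⟩
    have hle : densM volume (fun x => 1 - ρ x) ≤ (volume : Measure E) :=
      densM_le_volume (h.2.1.mono fun x hx => by linarith [hx.1])
    have : IsLocallyFiniteMeasure (densM volume fun x => 1 - ρ x : Measure E) :=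
      ⟨fun x => let ⟨s, hs, hlt⟩ := (volume : Measure E).finiteAt_nhds x
        ⟨s, hs, (hle s).trans_lt hlt⟩⟩
    refine Measure.le_iff.2 fun s hs => ?_
    rw [s.measure_eq_iInf_isOpen (densM volume fun x => 1 - ρ x)]
    refine le_iInf₂ fun G hsG => le_iInf fun hG => (measure_mono hsG).trans ?_
    rw [Measure.map_apply measurable_snd hG.measurableSet]
    refine (hopen _ (hG.preimage continuous_snd)).trans ?_
    refine liminf_le_of_frequently_le' (Eventually.of_forall fun n => ?_).frequently
    rw [← Measure.map_apply measurable_snd hG.measurableSet]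
    exact (hπ (φ n)).2 G
  exact ⟨Q, hAP, hcostQ.antisymm (planE_le hAP)⟩

end PlanEnergy

section Finiteness

variable {E : Type*} [NormedAddCommGroup E] [InnerProductSpace ℝ E] [FiniteDimensional ℝ E]
  [MeasurableSpace E] [BorelSpace E] {ρ : E → ℝ}

lemma exists_two_le_volume_ball [Nontrivial E] :
    ∃ R : ℝ, 0 < R ∧ ∀ x : E, 2 ≤ volume (ball x R) := by
  have h0 : volume (ball (0 : E) 1) ≠ 0 := (measure_ball_pos _ _ one_pos).ne'
  have ht : volume (ball (0 : E) 1) ≠ ∞ := measure_ball_lt_top.ne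
  set b := (volume (ball (0 : E) 1)).toReal with hb
  have hbpos : 0 < b := ENNReal.toReal_pos h0 ht
  refine ⟨max 1 (2 / b), by positivity, fun x => ?_⟩
  rw [Measure.addHaar_ball _ _ (by positivity), ← ENNReal.ofReal_toReal ht, ← hb,
    ← ENNReal.ofReal_mul (by positivity)]
  rw [show (2 : ℝ≥0∞) = ENNReal.ofReal 2 by simp]
  refine ENNReal.ofReal_le_ofReal ?_
  have h1 : max 1 (2 / b) ≤ max 1 (2 / b) ^ Module.finrank ℝ E :=
    le_self_pow₀ (le_max_left _ _) Module.finrank_pos.ne'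
  calc 2 = 2 / b * b := by field_simp
    _ ≤ _ := by gcongr; exact (le_max_right _ _).trans h1

lemma planE_ne_top [Nontrivial E] {p : ℝ} (hp : 0 < p) (h : memA volume 1 ρ) :
    planE p ρ ≠ ∞ := by
  obtain ⟨R, hR0, hR⟩ := exists_two_le_volume_ball (E := E)
  let D : Set (E × E) := {z | dist z.1 z.2 < R}
  have hD : MeasurableSet D := (isOpen_lt (by fun_prop) continuous_const).measurableSet
  let k : E × E → ℝ≥0∞ := D.indicator 1
  have hk : Measurable k := measurable_one.indicator hD
  let f : E → ℝ≥0∞ := fun x => ENNReal.ofReal (ρ x)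
  have hf : Measurable f := h.1.ennreal_ofReal
  let w : E → ℝ≥0∞ := fun x => ENNReal.ofReal (1 - ρ x)
  have hw : Measurable w := (measurable_const.sub h.1).ennreal_ofReal
  let m : E → ℝ≥0∞ := fun x => ∫⁻ y, w y * k (x, y)
  have hm : Measurable m :=
    ((hw.comp measurable_snd).mul hk).lintegral_prod_right'
  have hm_eq : ∀ x, m x = ∫⁻ y in ball x R, w y := fun x => by
    rw [← lintegral_indicator measurableSet_ball]
    refine lintegral_congr fun y => ?_
    by_cases hy : y ∈ ball x R
    · have : (x, y) ∈ D := by simpa [D, dist_comm] using hy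
      simp [k, hy, this]
    · have : (x, y) ∉ D := by simpa [D, dist_comm] using hy
      simp [k, hy, this]
  have hm1 : ∀ x, 1 ≤ m x := fun x => by
    have h2 : (2 : ℝ≥0∞) ≤ m x + 1 := calc
      2 ≤ volume (ball x R) := hR x
      _ = ∫⁻ y in ball x R, 1 := by simp
      _ ≤ ∫⁻ y in ball x R, (w y + f y) := by
        refine lintegral_mono_ae (ae_restrict_of_ae ?_)
        filter_upwards [h.2.1] with y hy
        simp only [w, f]
        rw [← ENNReal.ofReal_add (by linarith [hy.2]) hy.1]
        simp
      _ = m x + ∫⁻ y in ball x R, f y := by rw [lintegral_add_left hw, hm_eq]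
      _ ≤ m x + 1 := by
        gcongr
        rw [← lintegral_of_memA h]
        exact setLIntegral_le_lintegral _ _
    rw [show (2 : ℝ≥0∞) = 1 + 1 by norm_num] at h2
    exact (ENNReal.add_le_add_iff_right one_ne_top).1 h2
  have hmt : ∀ x, m x ≠ ∞ := fun x => by
    refine ne_top_of_le_ne_top (measure_ball_lt_top (μ := (volume : Measure E)) (x := x)
      (r := R)).ne ?_
    rw [hm_eq]
    calc ∫⁻ y in ball x R, w y ≤ ∫⁻ y in ball x R, 1 := by
          refine lintegral_mono_ae (ae_restrict_of_ae ?_)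
          filter_upwards [h.2.1] with y hy
          simpa [w] using hy.1
      _ = _ := by simp
  let g : E × E → ℝ≥0∞ := fun z => (f z.1 * (m z.1)⁻¹) * (w z.2 * k z)
  have hg : Measurable g :=
    ((hf.comp measurable_fst).mul (hm.comp measurable_fst).inv).mul
      ((hw.comp measurable_snd).mul hk)
  have hgx : ∀ x, ∫⁻ y, g (x, y) = f x := fun x => by
    simp only [g]
    have hwk : Measurable fun y => w y * k (x, y) := hw.mul (hk.comp measurable_prodMk_left)
    rw [lintegral_const_mul _ hwk, mul_assoc,
      ENNReal.inv_mul_cancel (zero_lt_one.trans_le (hm1 x)).ne' (hmt x), mul_one]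
  let π : Measure (E × E) := (volume : Measure (E × E)).withDensity g
  have hvol : (volume : Measure (E × E)) = (volume : Measure E).prod volume := rfl
  have hfst : π.map Prod.fst = densM volume ρ := by
    ext s hs
    rw [Measure.map_apply measurable_fst hs, withDensity_apply _ (measurable_fst hs),
      densM, withDensity_apply _ hs, ← Set.prod_univ, hvol,
      setLIntegral_prod _ hg.aemeasurable]
    simp [hgx, f]
  have hsnd : π.map Prod.snd ≤ densM volume fun x => 1 - ρ x := by
    refine Measure.le_iff.2 fun s hs => ?_
    rw [Measure.map_apply measurable_snd hs, withDensity_apply _ (measurable_snd hs),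
      densM, withDensity_apply _ hs, ← Set.univ_prod, hvol,
      setLIntegral_prod_symm _ hg.aemeasurable]
    refine lintegral_mono fun y => ?_
    simp only [Measure.restrict_univ]
    calc ∫⁻ x, g (x, y) ≤ ∫⁻ x, f x * w y := by
          refine lintegral_mono fun x => ?_
          simp only [g]
          have h1 : (m x)⁻¹ ≤ 1 := ENNReal.inv_le_one.2 (hm1 x)
          have h2 : k (x, y) ≤ 1 := indicator_le_self' (by simp) _
          calc f x * (m x)⁻¹ * (w y * k (x, y)) ≤ f x * 1 * (w y * 1) := by gcongr
            _ = f x * w y := by simp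
      _ = w y := by rw [lintegral_mul_const _ hf]; simp [f, lintegral_of_memA h]
  refine ne_top_of_le_ne_top (ENNReal.ofReal_ne_top (r := R ^ p)) ((planE_le ⟨hfst, hsnd⟩).trans ?_)
  calc tCost p π = ∫⁻ z, g z * ENNReal.ofReal (dist z.1 z.2 ^ p) := by
        rw [tCost, lintegral_withDensity_eq_lintegral_mul _ hg (measurable_tCost_integrand p)]
        rfl
    _ ≤ ∫⁻ z, g z * ENNReal.ofReal (R ^ p) := by
        refine lintegral_mono fun z => ?_
        by_cases hz : z ∈ D
        · have : dist z.1 z.2 ^ p ≤ R ^ p :=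
            Real.rpow_le_rpow dist_nonneg (le_of_lt hz) hp.le
          gcongr
        · simp [g, k, hz]
    _ = ENNReal.ofReal (R ^ p) := by
        rw [lintegral_mul_const _ hg, hvol, lintegral_prod _ hg.aemeasurable]
        simp only [hgx]
        simp [f, lintegral_of_memA h]

end Finiteness

section Reflection

variable {E : Type*} [NormedAddCommGroup E] [InnerProductSpace ℝ E]

/-- Signed distance to the hyperplane `⟪v, x⟫ = c`, for a unit vector `v`. -/
def hlevel (v : E) (c : ℝ) (x : E) : ℝ := inner ℝ v x - c

/-- Reflection across the hyperplane `⟪v, x⟫ = c`, for a unit vector `v`. -/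
def hrefl (v : E) (c : ℝ) (x : E) : E := x - (2 * hlevel v c x) • v

/-- The folding map onto the half-space `c ≤ ⟪v, x⟫`. -/
def hfold (v : E) (c : ℝ) (x : E) : E := if 0 ≤ hlevel v c x then x else hrefl v c x

lemma hlevel_neg (v : E) (c : ℝ) (x : E) : hlevel (-v) (-c) x = -hlevel v c x := by
  simp [hlevel, inner_neg_left]; ring

lemma hrefl_neg (v : E) (c : ℝ) : hrefl (-v) (-c) = hrefl v c := by
  funext x; simp [hrefl, hlevel_neg]

@[fun_prop]
lemma continuous_hlevel (v : E) (c : ℝ) : Continuous (hlevel v c) := by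
  unfold hlevel; fun_prop

@[fun_prop]
lemma continuous_hrefl (v : E) (c : ℝ) : Continuous (hrefl v c) := by
  unfold hrefl; fun_prop

variable {v : E} {c : ℝ}

lemma hlevel_hrefl (hv : ‖v‖ = 1) (x : E) : hlevel v c (hrefl v c x) = -hlevel v c x := by
  simp only [hrefl, hlevel, inner_sub_right, inner_smul_right, real_inner_self_eq_norm_sq, hv]
  ring

lemma hrefl_hrefl (hv : ‖v‖ = 1) (x : E) : hrefl v c (hrefl v c x) = x := by
  rw [hrefl, hlevel_hrefl hv, hrefl]
  simp [sub_eq_add_neg]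

lemma dist_hrefl_hrefl (hv : ‖v‖ = 1) (x y : E) :
    dist (hrefl v c x) (hrefl v c y) = dist x y := by
  rw [dist_eq_norm, dist_eq_norm, ← sq_eq_sq₀ (norm_nonneg _) (norm_nonneg _)]
  have : hrefl v c x - hrefl v c y = (x - y) - (2 * inner ℝ v (x - y)) • v := by
    simp only [hrefl, hlevel, inner_sub_right]
    module
  rw [this, norm_sub_sq_real, inner_smul_right, norm_smul, hv, real_inner_comm v, mul_one,
    Real.norm_eq_abs, sq_abs]
  ring

lemma hfold_of_nonneg {x : E} (h : 0 ≤ hlevel v c x) : hfold v c x = x := if_pos h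

lemma hfold_of_neg {x : E} (h : hlevel v c x < 0) : hfold v c x = hrefl v c x := if_neg h.not_ge

lemma hfold_of_nonpos {x : E} (h : hlevel v c x ≤ 0) : hfold v c x = hrefl v c x := by
  rcases h.lt_or_eq with h | h
  · exact hfold_of_neg h
  · rw [hfold_of_nonneg h.ge, hrefl, h]; simp

lemma hfold_hrefl (hv : ‖v‖ = 1) (x : E) : hfold v c (hrefl v c x) = hfold v c x := by
  rcases le_total 0 (hlevel v c x) with h | h
  · rw [hfold_of_nonneg h, hfold_of_nonpos (by rw [hlevel_hrefl hv]; linarith), hrefl_hrefl hv]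
  · rw [hfold_of_nonpos h, hfold_of_nonneg (by rw [hlevel_hrefl hv]; linarith)]

lemma hlevel_hfold_nonneg (hv : ‖v‖ = 1) (x : E) : 0 ≤ hlevel v c (hfold v c x) := by
  rcases le_total 0 (hlevel v c x) with h | h
  · rwa [hfold_of_nonneg h]
  · rw [hfold_of_nonpos h, hlevel_hrefl hv]; linarith

lemma dist_hrefl_le (hv : ‖v‖ = 1) {x y : E} (hx : 0 ≤ hlevel v c x) (hy : hlevel v c y ≤ 0) :
    dist x (hrefl v c y) ≤ dist x y := by
  rw [dist_eq_norm, dist_eq_norm, ← sq_le_sq₀ (norm_nonneg _) (norm_nonneg _)]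
  have : x - hrefl v c y = (x - y) + (2 * hlevel v c y) • v := by
    simp only [hrefl]; module
  have hi : inner ℝ v (x - y) = hlevel v c x - hlevel v c y := by
    simp only [hlevel, inner_sub_right]; ring
  rw [this, norm_add_sq_real, inner_smul_right, norm_smul, hv, real_inner_comm v, mul_one,
    Real.norm_eq_abs, sq_abs, hi]
  nlinarith [mul_nonneg hx (neg_nonneg.2 hy)]

lemma dist_hfold_le (hv : ‖v‖ = 1) (x y : E) : dist (hfold v c x) (hfold v c y) ≤ dist x y := by
  rcases le_total 0 (hlevel v c x) with hx | hx <;> rcases le_total 0 (hlevel v c y) with hy | hy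
  · rw [hfold_of_nonneg hx, hfold_of_nonneg hy]
  · rw [hfold_of_nonneg hx, hfold_of_nonpos hy]
    exact dist_hrefl_le hv hx hy
  · rw [hfold_of_nonpos hx, hfold_of_nonneg hy, dist_comm, dist_comm x]
    exact dist_hrefl_le hv hy hx
  · rw [hfold_of_nonpos hx, hfold_of_nonpos hy, dist_hrefl_hrefl hv]

variable [MeasurableSpace E]

/-- The part of `μ` in the half-space `c < ⟪v, x⟫`, plus its mirror image. -/
def hdouble (v : E) (c : ℝ) (μ : Measure E) : Measure E :=
  μ.restrict {x | 0 < hlevel v c x} + (μ.restrict {x | 0 < hlevel v c x}).map (hrefl v c)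

variable [BorelSpace E]

lemma measurable_hfold (v : E) (c : ℝ) : Measurable (hfold v c) :=
  Measurable.ite (measurableSet_le measurable_const (continuous_hlevel v c).measurable)
    measurable_id (continuous_hrefl v c).measurable

lemma measurableSet_hlevel_pos (v : E) (c : ℝ) : MeasurableSet {x | 0 < hlevel v c x} :=
  measurableSet_lt measurable_const (continuous_hlevel v c).measurable

lemma hdouble_mono {μ ν : Measure E} (h : μ ≤ ν) : hdouble v c μ ≤ hdouble v c ν := by
  have hr : μ.restrict {x | 0 < hlevel v c x} ≤ ν.restrict {x | 0 < hlevel v c x} :=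
    Measure.restrict_mono le_rfl h
  exact add_le_add hr (Measure.map_mono hr (continuous_hrefl v c).measurable)

lemma hdouble_univ (μ : Measure E) :
    hdouble v c μ univ = 2 * μ {x | 0 < hlevel v c x} := by
  rw [hdouble, Measure.add_apply, Measure.map_apply (continuous_hrefl v c).measurable
    MeasurableSet.univ]
  simp [two_mul]

lemma restrict_add_restrict_hlevel {α : Type*} [MeasurableSpace α] {μ : Measure α} {f : α → E}
    (hf : Measurable f) (h : ∀ᵐ x ∂μ, hlevel v c (f x) ≠ 0) :
    μ.restrict {x | 0 < hlevel v c (f x)} + μ.restrict {x | 0 < hlevel (-v) (-c) (f x)} = μ := by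
  have hA : MeasurableSet {x | 0 < hlevel v c (f x)} := hf (measurableSet_hlevel_pos v c)
  have : μ.restrict {x | 0 < hlevel (-v) (-c) (f x)} =
      μ.restrict {x | 0 < hlevel v c (f x)}ᶜ := by
    refine Measure.restrict_congr_set ?_
    filter_upwards [h] with x hx
    refine propext ?_
    show 0 < hlevel (-v) (-c) (f x) ↔ ¬ 0 < hlevel v c (f x)
    rw [hlevel_neg, neg_pos, not_lt]
    exact ⟨le_of_lt, fun h => lt_of_le_of_ne h hx⟩
  rw [this, Measure.restrict_add_restrict_compl hA]

lemma map_hfold_hdouble (hv : ‖v‖ = 1) (μ : Measure E) :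
    (hdouble v c μ).map (hfold v c) = (2 : ℝ≥0∞) • μ.restrict {x | 0 < hlevel v c x} := by
  have hH := measurableSet_hlevel_pos v c
  have hF := measurable_hfold v c
  rw [hdouble, Measure.map_add _ _ hF, Measure.map_map hF (continuous_hrefl v c).measurable]
  have h1 : (μ.restrict {x | 0 < hlevel v c x}).map (hfold v c) =
      μ.restrict {x | 0 < hlevel v c x} := by
    conv_rhs => rw [← Measure.map_id (μ := μ.restrict {x | 0 < hlevel v c x})]
    refine Measure.map_congr ?_
    filter_upwards [ae_restrict_mem hH] with x hx
    exact hfold_of_nonneg (le_of_lt hx)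
  have h2 : hfold v c ∘ hrefl v c = hfold v c := funext (hfold_hrefl hv)
  rw [h2, h1, two_smul]

variable [FiniteDimensional ℝ E]

lemma measurePreserving_hrefl (hv : ‖v‖ = 1) :
    MeasurePreserving (hrefl v c) (volume : Measure E) volume := by
  have h := (measurePreserving_add_right (volume : Measure E) ((2 * c) • v)).comp
    ((ℝ ∙ v)ᗮ.reflection.measurePreserving)
  suffices hrefl v c = (fun x => x + (2 * c) • v) ∘ (ℝ ∙ v)ᗮ.reflection by rwa [this]
  funext x
  simp only [Function.comp, Submodule.reflection_orthogonal_apply,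
    Submodule.reflection_singleton_apply, hrefl, hlevel, hv]
  simp only [RCLike.ofReal_real_eq_id, id_eq, one_pow, div_one]
  module

lemma hlevel_ae_ne (hv : ‖v‖ = 1) (c : ℝ) : ∀ᵐ x : E, hlevel v c x ≠ 0 := by
  have h := Measure.addHaar_affineSubspace (volume : Measure E)
    (AffineSubspace.mk' (c • v) (ℝ ∙ v)ᗮ) (fun htop => by
      have : c • v + v ∈ AffineSubspace.mk' (c • v) (ℝ ∙ v)ᗮ := by rw [htop]; trivial
      rw [AffineSubspace.mem_mk', vsub_eq_sub,
        Submodule.mem_orthogonal_singleton_iff_inner_right] at this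
      simp [hv] at this)
  rw [ae_iff]
  convert h using 2
  ext x
  simp [AffineSubspace.mem_mk', Submodule.mem_orthogonal_singleton_iff_inner_right, hlevel,
    inner_sub_right, inner_smul_right, hv]

lemma densM_comp_hfold (hv : ‖v‖ = 1) {g : E → ℝ} (hg : Measurable g) :
    densM volume (g ∘ hfold v c) = hdouble v c (densM volume g) := by
  have hH := measurableSet_hlevel_pos v c
  let k : E → ℝ≥0∞ := {x | 0 < hlevel v c x}.indicator fun x => ENNReal.ofReal (g x)
  have hk : Measurable k := hg.ennreal_ofReal.indicator hH
  have h1 : (densM volume g).restrict {x | 0 < hlevel v c x} = volume.withDensity k := by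
    rw [densM, restrict_withDensity hH, withDensity_indicator hH]
  have h2 : (volume.withDensity k).map (hrefl v c) = volume.withDensity (k ∘ hrefl v c) := by
    ext s hs
    have hm := (continuous_hrefl v c).measurable
    rw [Measure.map_apply hm hs, withDensity_apply _ (hm hs), withDensity_apply _ hs,
      ← (measurePreserving_hrefl (c := c) hv).setLIntegral_comp_preimage hs (hk.comp hm)]
    simp [hrefl_hrefl hv]
  rw [hdouble, h1, h2, ← withDensity_add_left hk, densM]
  refine withDensity_congr_ae ?_
  filter_upwards [hlevel_ae_ne hv c] with x hx
  rcases hx.lt_or_gt with h | h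
  · have : ¬ 0 < hlevel v c x := h.not_gt
    simp [k, hfold_of_neg h, this, hlevel_hrefl hv, h]
  · have : ¬ 0 < -hlevel v c x := by linarith
    simp only [Function.comp, Pi.add_apply, k, indicator, mem_ofPred_eq, hlevel_hrefl hv, h,
      this, if_true, if_false, add_zero, hfold_of_nonneg h.le]

end Reflection

section Folding

variable {E : Type*} [NormedAddCommGroup E] [InnerProductSpace ℝ E] [FiniteDimensional ℝ E]
  [MeasurableSpace E] [BorelSpace E] {ρ : E → ℝ} {p : ℝ} {v : E} {c : ℝ} {π : Measure (E × E)}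

/-- `ρ` maximizes the least plan cost among densities of mass one. -/
def IsMaxDensity (p : ℝ) (ρ : E → ℝ) : Prop :=
  memA volume 1 ρ ∧ ∀ σ : E → ℝ, memA volume 1 σ → planE p σ ≤ planE p ρ

/-- `π` is an admissible plan of least cost for `ρ`. -/
def IsOptPlan (p : ℝ) (ρ : E → ℝ) (π : Measure (E × E)) : Prop :=
  AP volume ρ π ∧ tCost p π = planE p ρ

/-- The half-space `c < ⟪v, x⟫` carries half of the mass of `ρ`. -/
def Bisects (v : E) (c : ℝ) (ρ : E → ℝ) : Prop :=
  densM volume ρ {x | 0 < hlevel v c x} = 2⁻¹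

/-- The part of the plan starting in the half-space `c < ⟪v, x⟫`, plus its mirror image. -/
def planDouble (v : E) (c : ℝ) (π : Measure (E × E)) : Measure (E × E) :=
  π.restrict {z | 0 < hlevel v c z.1} +
    (π.restrict {z | 0 < hlevel v c z.1}).map (Prod.map (hrefl v c) (hrefl v c))

lemma ae_fst_of_AP (h : AP volume ρ π) {P : E → Prop} (hP : ∀ᵐ x, P x) : ∀ᵐ z ∂π, P z.1 := by
  have : ∀ᵐ x ∂π.map Prod.fst, P x := by rw [h.1]; exact (densM_ac ρ).ae_le hP
  exact ae_of_ae_map measurable_fst.aemeasurable this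

lemma ae_snd_of_AP (h : AP volume ρ π) {P : E → Prop} (hP : ∀ᵐ x, P x) : ∀ᵐ z ∂π, P z.2 := by
  have : ∀ᵐ x ∂π.map Prod.snd, P x :=
    ((Measure.absolutelyContinuous_of_le h.2).trans (densM_ac _)).ae_le hP
  exact ae_of_ae_map measurable_snd.aemeasurable this

lemma bisects_neg (hv : ‖v‖ = 1) (h : memA volume 1 ρ) (hb : Bisects v c ρ) :
    Bisects (-v) (-c) ρ := by
  have hsum := restrict_add_restrict_hlevel (v := v) (c := c) (μ := densM volume ρ) measurable_id
    ((densM_ac ρ).ae_le (hlevel_ae_ne hv c))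
  have := congrArg (fun m => m univ) hsum
  simp only [id, Measure.add_apply, Measure.restrict_apply_univ, densM_univ h] at this
  rw [Bisects] at hb ⊢
  rw [hb] at this
  have h2 : (1 : ℝ≥0∞) = 2⁻¹ + 2⁻¹ := (ENNReal.inv_two_add_inv_two).symm
  rw [h2] at this
  exact (ENNReal.add_right_inj (by simp)).1 this

lemma memA_comp_hfold (hv : ‖v‖ = 1) (h : memA volume 1 ρ) (hb : Bisects v c ρ) :
    memA volume 1 (ρ ∘ hfold v c) := by
  refine memA_of_lintegral (h.1.comp (measurable_hfold v c)) ?_ ?_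
  · filter_upwards [h.2.1, (measurePreserving_hrefl (c := c) hv).quasiMeasurePreserving.ae h.2.1]
      with x h1 h2
    simp only [Function.comp, hfold]
    split_ifs
    exacts [h1, h2]
  · have := congrArg (fun m => m univ) (densM_comp_hfold (c := c) hv h.1)
    simp only [hdouble_univ] at this
    rw [hb, ENNReal.mul_inv_cancel (by simp) (by simp), densM,
      withDensity_apply _ MeasurableSet.univ, setLIntegral_univ] at this
    exact this

/-- Half of the folded image of a plan for the folded density. -/
lemma map_fold_half (hv : ‖v‖ = 1) (h : memA volume 1 ρ) {π : Measure (E × E)}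
    (hπ : AP volume (ρ ∘ hfold v c) π) :
    ((2⁻¹ : ℝ≥0∞) • π.map (Prod.map (hfold v c) (hfold v c))).map Prod.fst =
        (densM volume ρ).restrict {x | 0 < hlevel v c x} ∧
      ((2⁻¹ : ℝ≥0∞) • π.map (Prod.map (hfold v c) (hfold v c))).map Prod.snd ≤
        (densM volume fun x => 1 - ρ x).restrict {x | 0 < hlevel v c x} := by
  have hF := measurable_hfold v c
  have hFF : Measurable (Prod.map (hfold v c) (hfold v c)) := hF.prodMap hF
  have h1 : Measurable fun x => 1 - ρ x := measurable_const.sub h.1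
  have hh : ∀ μ : Measure E, (2⁻¹ : ℝ≥0∞) • (2 : ℝ≥0∞) • μ = μ := fun μ => by
    rw [smul_smul, ENNReal.inv_mul_cancel (by simp) (by simp), one_smul]
  constructor
  · rw [Measure.map_smul, Measure.map_map measurable_fst hFF]
    change (2⁻¹ : ℝ≥0∞) • π.map (hfold v c ∘ Prod.fst) = _
    rw [← Measure.map_map hF measurable_fst, hπ.1, densM_comp_hfold hv h.1,
      map_hfold_hdouble hv, hh]
  · rw [Measure.map_smul, Measure.map_map measurable_snd hFF]
    change (2⁻¹ : ℝ≥0∞) • π.map (hfold v c ∘ Prod.snd) ≤ _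
    rw [← Measure.map_map hF measurable_snd]
    calc (2⁻¹ : ℝ≥0∞) • (π.map Prod.snd).map (hfold v c)
        ≤ (2⁻¹ : ℝ≥0∞) • (densM volume ((fun x => 1 - ρ x) ∘ hfold v c)).map (hfold v c) := by
          have := Measure.map_mono hπ.2 hF
          exact smul_mono_right _ this
      _ = _ := by
        rw [densM_comp_hfold hv h1, map_hfold_hdouble hv, hh]

/-- The plan for `ρ` obtained from plans for its two folded densities. -/
def glue (v : E) (c : ℝ) (π₁ π₂ : Measure (E × E)) : Measure (E × E) :=
  (2⁻¹ : ℝ≥0∞) • π₁.map (Prod.map (hfold v c) (hfold v c)) +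
    (2⁻¹ : ℝ≥0∞) • π₂.map (Prod.map (hfold (-v) (-c)) (hfold (-v) (-c)))

lemma AP_glue (hv : ‖v‖ = 1) (h : memA volume 1 ρ) {π₁ π₂ : Measure (E × E)}
    (h₁ : AP volume (ρ ∘ hfold v c) π₁) (h₂ : AP volume (ρ ∘ hfold (-v) (-c)) π₂) :
    AP volume ρ (glue v c π₁ π₂) := by
  have hv' : ‖-v‖ = 1 := by rwa [norm_neg]
  have e₁ := map_fold_half hv h h₁
  have e₂ := map_fold_half hv' h h₂
  have hsum : ∀ {g : E → ℝ}, (densM volume g).restrict {x | 0 < hlevel v c x} +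
      (densM volume g).restrict {x | 0 < hlevel (-v) (-c) x} = densM volume g := fun {g} =>
    restrict_add_restrict_hlevel measurable_id ((densM_ac g).ae_le (hlevel_ae_ne hv c))
  refine ⟨?_, ?_⟩
  · rw [glue, Measure.map_add _ _ measurable_fst, e₁.1, e₂.1, hsum]
  · rw [glue, Measure.map_add _ _ measurable_snd, ← hsum]
    exact add_le_add e₁.2 e₂.2

lemma tCost_map_hfold_le (hp : 0 < p) (hv : ‖v‖ = 1) (π : Measure (E × E)) :
    tCost p (π.map (Prod.map (hfold v c) (hfold v c))) ≤ tCost p π := by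
  rw [tCost_map p ((measurable_hfold v c).prodMap (measurable_hfold v c))]
  refine lintegral_mono fun z => ENNReal.ofReal_le_ofReal ?_
  exact Real.rpow_le_rpow dist_nonneg (dist_hfold_le hv _ _) hp.le

lemma tCost_glue_le (hp : 0 < p) (hv : ‖v‖ = 1) (π₁ π₂ : Measure (E × E)) :
    tCost p (glue v c π₁ π₂) ≤ 2⁻¹ * (tCost p π₁ + tCost p π₂) := by
  have hv' : ‖-v‖ = 1 := by rwa [norm_neg]
  rw [glue, tCost_add, tCost_smul, tCost_smul, mul_add]
  gcongr
  exacts [tCost_map_hfold_le hp hv _, tCost_map_hfold_le hp hv' _]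

lemma glue_same_side (hv : ‖v‖ = 1) (π₁ π₂ : Measure (E × E)) :
    ∀ᵐ z ∂glue v c π₁ π₂, z ∈ {z : E × E | 0 ≤ hlevel v c z.1 * hlevel v c z.2} := by
  have hv' : ‖-v‖ = 1 := by rwa [norm_neg]
  have hS : MeasurableSet {z : E × E | 0 ≤ hlevel v c z.1 * hlevel v c z.2} :=
    (isClosed_le continuous_const (by fun_prop)).measurableSet
  have hF := fun w d => (measurable_hfold (E := E) w d).prodMap (measurable_hfold w d)
  rw [glue, ae_add_measure_iff]
  refine ⟨Measure.ae_smul_measure ?_ _, Measure.ae_smul_measure ?_ _⟩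
  · exact (ae_map_iff (hF v c).aemeasurable hS).2 (Eventually.of_forall fun z =>
      mul_nonneg (hlevel_hfold_nonneg hv _) (hlevel_hfold_nonneg hv _))
  · refine (ae_map_iff (hF (-v) (-c)).aemeasurable hS).2 (Eventually.of_forall fun z => ?_)
    have a := hlevel_hfold_nonneg (c := -c) hv' z.1
    have b := hlevel_hfold_nonneg (c := -c) hv' z.2
    rw [hlevel_neg] at a b
    exact mul_nonneg_of_nonpos_of_nonpos (neg_nonneg.1 a) (neg_nonneg.1 b)

lemma exists_same_side_optPlan (hp : 1 < p) (hv : ‖v‖ = 1) (hmax : IsMaxDensity p ρ)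
    (hb : Bisects v c ρ) : planE p ρ ≠ ∞ ∧ planE p (ρ ∘ hfold v c) = planE p ρ ∧
    ∃ π', IsOptPlan p ρ π' ∧
      ∀ᵐ z ∂π', z ∈ {z : E × E | 0 ≤ hlevel v c z.1 * hlevel v c z.2} := by
  have hv' : ‖-v‖ = 1 := by rwa [norm_neg]
  have : Nontrivial E := ⟨v, 0, fun h => by simp [h] at hv⟩
  have hp0 : 0 < p := by linarith
  have m₁ := memA_comp_hfold hv hmax.1 hb
  have m₂ := memA_comp_hfold hv' hmax.1 (bisects_neg hv hmax.1 hb)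
  obtain ⟨π₁, a₁, c₁⟩ := exists_AP_tCost_eq hp m₁ (planE_ne_top hp0 m₁)
  obtain ⟨π₂, a₂, c₂⟩ := exists_AP_tCost_eq hp m₂ (planE_ne_top hp0 m₂)
  have hfin := planE_ne_top hp0 hmax.1
  have hAP := AP_glue hv hmax.1 a₁ a₂
  have hle := tCost_glue_le (c := c) hp0 hv π₁ π₂
  have hge := planE_le (p := p) hAP
  have l₁ := hmax.2 _ m₁
  have l₂ := hmax.2 _ m₂
  rw [c₁, c₂] at hle
  have hhalf : ∀ a : ℝ≥0∞, 2⁻¹ * (a + a) = a := fun a => by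
    rw [← two_mul, ← mul_assoc, ENNReal.inv_mul_cancel (by simp) (by simp), one_mul]
  refine ⟨hfin, l₁.antisymm ?_, glue v c π₁ π₂, ⟨hAP, hge.antisymm' (hle.trans ?_)⟩,
    glue_same_side hv _ _⟩
  · have : 2⁻¹ * (planE p ρ + planE p ρ) ≤ 2⁻¹ * (planE p (ρ ∘ hfold v c) + planE p ρ) := by
      rw [hhalf]
      refine (hge.trans hle).trans ?_
      gcongr
    rw [ENNReal.mul_le_mul_iff_right (by simp) (by simp)] at this
    exact (ENNReal.add_le_add_iff_right hfin).1 this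
  · rw [← hhalf (planE p ρ)]
    gcongr

lemma no_crossing (hp : 1 < p) (hv : ‖v‖ = 1) (hmax : IsMaxDensity p ρ)
    (hb : Bisects v c ρ) (hopt : IsOptPlan p ρ π) :
    ∀ᵐ z ∂π, 0 ≤ hlevel v c z.1 * hlevel v c z.2 := by
  obtain ⟨hfin, -, π', ho', hside⟩ := exists_same_side_optPlan hp hv hmax hb
  have i₁ := isProbabilityMeasure_of_AP hmax.1 hopt.1
  have i₂ := isProbabilityMeasure_of_AP hmax.1 ho'.1
  refine concentrated_of_sum_optimal hp (π := π) (π' := π') ?_ ?_ ?_ ?_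
    (F := {z : E × E | 0 ≤ hlevel v c z.1 * hlevel v c z.2})
    (isClosed_le continuous_const (by fun_prop)) hside
  · rw [hopt.1.1]; exact densM_ac ρ
  · rw [hopt.1.1, ho'.1.1]
  · rw [tCost_add, hopt.2, ho'.2]; exact ENNReal.add_ne_top.2 ⟨hfin, hfin⟩
  · intro γ' h₁ h₂
    rw [Measure.map_add _ _ measurable_fst, hopt.1.1, ho'.1.1] at h₁
    rw [Measure.map_add _ _ measurable_snd] at h₂
    have hh : ∀ μ : Measure E, (2⁻¹ : ℝ≥0∞) • (μ + μ) = μ := fun μ => by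
      rw [← two_smul ℝ≥0∞ μ, smul_smul, ENNReal.inv_mul_cancel (by simp) (by simp), one_smul]
    have hAP : AP volume ρ ((2⁻¹ : ℝ≥0∞) • γ') := by
      refine ⟨by rw [Measure.map_smul, h₁, hh], ?_⟩
      rw [Measure.map_smul, h₂, ← hh (densM volume fun x => 1 - ρ x)]
      gcongr
      exacts [hopt.1.2, ho'.1.2]
    have := planE_le (p := p) hAP
    rw [tCost_smul] at this
    rw [tCost_add, hopt.2, ho'.2, ← two_mul]
    calc 2 * planE p ρ ≤ 2 * (2⁻¹ * tCost p γ') := by gcongr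
      _ = tCost p γ' := by
        rw [← mul_assoc, ENNReal.mul_inv_cancel (by simp) (by simp), one_mul]

lemma tCost_planDouble (hv : ‖v‖ = 1) :
    tCost p (planDouble v c π) = 2 * tCost p (π.restrict {z | 0 < hlevel v c z.1}) := by
  have hm := (continuous_hrefl v c).measurable
  rw [planDouble, tCost_add, tCost_map p (hm.prodMap hm), two_mul]
  simp only [Prod.map_fst, Prod.map_snd, dist_hrefl_hrefl hv]
  rfl

lemma AP_planDouble (hp : 1 < p) (hv : ‖v‖ = 1) (hmax : IsMaxDensity p ρ)
    (hb : Bisects v c ρ) (hopt : IsOptPlan p ρ π) :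
    AP volume (ρ ∘ hfold v c) (planDouble v c π) := by
  have hm := (continuous_hrefl v c).measurable
  have hH := measurableSet_hlevel_pos v c
  have hset : (π.restrict {z | 0 < hlevel v c z.1}) = π.restrict {z | 0 < hlevel v c z.2} := by
    refine Measure.restrict_congr_set ?_
    filter_upwards [no_crossing hp hv hmax hb hopt, ae_fst_of_AP hopt.1 (hlevel_ae_ne hv c),
      ae_snd_of_AP hopt.1 (hlevel_ae_ne hv c)] with z h h₁ h₂
    refine propext ⟨fun h0 => ?_, fun h0 => ?_⟩
    · exact lt_of_le_of_ne (nonneg_of_mul_nonneg_right h h0) h₂.symm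
    · exact lt_of_le_of_ne (nonneg_of_mul_nonneg_left h h0) h₁.symm
  have f₁ : (π.restrict {z | 0 < hlevel v c z.1}).map Prod.fst =
      (densM volume ρ).restrict {x | 0 < hlevel v c x} := by
    rw [← hopt.1.1, Measure.restrict_map measurable_fst hH]; rfl
  have f₂ : (π.restrict {z | 0 < hlevel v c z.1}).map Prod.snd =
      (π.map Prod.snd).restrict {x | 0 < hlevel v c x} := by
    rw [hset, Measure.restrict_map measurable_snd hH]; rfl
  constructor
  · rw [densM_comp_hfold hv hmax.1.1, hdouble, planDouble, Measure.map_add _ _ measurable_fst,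
      Measure.map_map measurable_fst (hm.prodMap hm)]
    change _ + Measure.map (hrefl v c ∘ Prod.fst) _ = _
    rw [← Measure.map_map hm measurable_fst, f₁]
  · change _ ≤ densM volume ((fun x => 1 - ρ x) ∘ hfold v c)
    have h1 : Measurable fun x => 1 - ρ x := measurable_const.sub hmax.1.1
    rw [densM_comp_hfold hv h1]
    refine le_trans (le_of_eq ?_) (hdouble_mono hopt.1.2)
    rw [hdouble, planDouble, Measure.map_add _ _ measurable_snd,
      Measure.map_map measurable_snd (hm.prodMap hm)]
    change _ + Measure.map (hrefl v c ∘ Prod.snd) _ = _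
    rw [← Measure.map_map hm measurable_snd, f₂]

/-- Folding a maximizer across a bisecting hyperplane gives a maximizer, and each half of an
optimal plan carries half of the cost. -/
lemma fold_maximizer (hp : 1 < p) (hv : ‖v‖ = 1) (hmax : IsMaxDensity p ρ)
    (hb : Bisects v c ρ) (hopt : IsOptPlan p ρ π) :
    IsMaxDensity p (ρ ∘ hfold v c) ∧ IsOptPlan p (ρ ∘ hfold v c) (planDouble v c π) := by
  have hv' : ‖-v‖ = 1 := by rwa [norm_neg]
  have hb' := bisects_neg hv hmax.1 hb
  obtain ⟨hfin, he, -⟩ := exists_same_side_optPlan hp hv hmax hb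
  obtain ⟨-, he', -⟩ := exists_same_side_optPlan hp hv' hmax hb'
  have hAP := AP_planDouble hp hv hmax hb hopt
  have l₁ := planE_le (p := p) hAP
  have l₂ := planE_le (p := p) (AP_planDouble hp hv' hmax hb' hopt)
  have hsum : tCost p (planDouble v c π) + tCost p (planDouble (-v) (-c) π) =
      planE p ρ + planE p ρ := by
    rw [tCost_planDouble hv, tCost_planDouble hv', ← mul_add, ← tCost_add,
      restrict_add_restrict_hlevel measurable_fst (ae_fst_of_AP hopt.1 (hlevel_ae_ne hv c)),
      hopt.2, two_mul]
  rw [he] at l₁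
  rw [he'] at l₂
  refine ⟨⟨memA_comp_hfold hv hmax.1 hb, fun σ hσ => he ▸ hmax.2 σ hσ⟩, hAP, ?_⟩
  rw [he]
  refine le_antisymm ?_ l₁
  have : tCost p (planDouble v c π) + planE p ρ ≤ planE p ρ + planE p ρ := by
    rw [← hsum]; gcongr
  exact (ENNReal.add_le_add_iff_right hfin).1 this

end Folding

section Bisection

variable {E : Type*} [NormedAddCommGroup E] [InnerProductSpace ℝ E] [FiniteDimensional ℝ E]
  [MeasurableSpace E] [BorelSpace E] {ρ : E → ℝ} {p : ℝ} {v : E}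

lemma continuous_cdf_of_noAtoms (μ : Measure ℝ) [IsProbabilityMeasure μ] [NullSingletonClass μ] :
    Continuous (ProbabilityTheory.cdf μ) := by
  refine continuous_iff_continuousAt.2 fun x => ?_
  rw [(ProbabilityTheory.cdf μ).mono.continuousAt_iff_leftLim_eq_rightLim,
    StieltjesFunction.rightLim_eq]
  have h := (ProbabilityTheory.cdf μ).measure_singleton x
  rw [ProbabilityTheory.measure_cdf, measure_singleton, eq_comm, ENNReal.ofReal_eq_zero] at h
  exact ((ProbabilityTheory.cdf μ).mono.leftLim_le le_rfl).antisymm (by linarith)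

lemma exists_bisects (hv : ‖v‖ = 1) (h : memA volume 1 ρ) : ∃ c, Bisects v c ρ := by
  have hm : Measurable fun x : E => (inner ℝ v x : ℝ) := by fun_prop
  have : IsProbabilityMeasure (densM volume ρ) := ⟨densM_univ h⟩
  set μ := (densM volume ρ).map fun x : E => (inner ℝ v x : ℝ) with hμ
  have : IsProbabilityMeasure μ := Measure.isProbabilityMeasure_map hm.aemeasurable
  have : NullSingletonClass μ := ⟨fun c => by
    rw [hμ, Measure.map_apply hm (measurableSet_singleton c)]
    refine densM_ac ρ ?_
    have := hlevel_ae_ne hv c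
    rw [ae_iff] at this
    convert this using 2
    ext x
    simp [hlevel, sub_eq_zero]⟩
  have h0 := ProbabilityTheory.tendsto_cdf_atBot μ
  have h1 := ProbabilityTheory.tendsto_cdf_atTop μ
  obtain ⟨a, ha⟩ := (h0.eventually (gt_mem_nhds (by norm_num : (0 : ℝ) < 2⁻¹))).exists
  obtain ⟨b, hb⟩ := (h1.eventually (lt_mem_nhds (by norm_num : (2⁻¹ : ℝ) < 1))).exists
  obtain ⟨c, hc⟩ := mem_range_of_exists_le_of_exists_ge (continuous_cdf_of_noAtoms μ)
    ⟨a, ha.le⟩ ⟨b, hb.le⟩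
  refine ⟨c, ?_⟩
  have hI : μ (Iic c) = 2⁻¹ := by
    rw [← ProbabilityTheory.ofReal_cdf, hc, ENNReal.ofReal_inv_of_pos (by norm_num)]
    simp
  have hc' : μ (Ioi c) = 2⁻¹ := by
    rw [← compl_Iic, prob_compl_eq_one_sub measurableSet_Iic, hI, ENNReal.one_sub_inv_two]
  rw [Bisects, ← hc', hμ, Measure.map_apply hm measurableSet_Ioi]
  congr 1
  ext x
  simp [hlevel]

lemma bisects_of_symmetric (hv : ‖v‖ = 1) (h : memA volume 1 ρ) {a : E}
    (hsymm : ∀ x, ρ ((2 : ℝ) • a - x) = ρ x) : Bisects v (inner ℝ v a) ρ := by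
  set c : ℝ := inner ℝ v a with hc
  have hH := measurableSet_hlevel_pos v c
  have hH' := measurableSet_hlevel_pos (-v) (-c)
  have heq : densM volume ρ {x | 0 < hlevel v c x} =
      densM volume ρ {x | 0 < hlevel (-v) (-c) x} := by
    rw [densM, withDensity_apply _ hH, withDensity_apply _ hH',
      ← (Measure.measurePreserving_sub_left (volume : Measure E) ((2 : ℝ) • a)).setLIntegral_comp_preimage
        hH' h.1.ennreal_ofReal]
    simp only [hsymm]
    congr 2
    ext x
    simp only [hlevel, mem_preimage, mem_ofPred_eq, inner_sub_right, inner_neg_left,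
      inner_smul_right, ← hc]
    constructor <;> intro h <;> linarith
  have hsum := restrict_add_restrict_hlevel (v := v) (c := c) (μ := densM volume ρ) measurable_id
    ((densM_ac ρ).ae_le (hlevel_ae_ne hv c))
  have := congrArg (fun m => m univ) hsum
  simp only [id, Measure.add_apply, Measure.restrict_apply_univ, densM_univ h, ← heq] at this
  rw [← two_mul] at this
  rw [Bisects]
  exact ENNReal.eq_inv_of_mul_eq_one_left (by rwa [mul_comm])

end Bisection

section Radial

variable {E : Type*} [NormedAddCommGroup E] [InnerProductSpace ℝ E]

lemma inner_eq_norm_mul_of_forall {x y : E}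
    (h : ∀ w : E, 0 ≤ (inner ℝ w x : ℝ) * inner ℝ w y) : (inner ℝ y x : ℝ) = ‖y‖ * ‖x‖ := by
  rcases eq_or_ne x 0 with rfl | hx
  · simp
  rcases eq_or_ne y 0 with rfl | hy
  · simp
  have hx' := norm_pos_iff.2 hx
  have hy' := norm_pos_iff.2 hy
  have := h (‖y‖ • x - ‖x‖ • y)
  simp only [inner_sub_left, inner_smul_left, real_inner_self_eq_norm_sq, RCLike.conj_to_real,
    real_inner_comm y x] at this
  rw [real_inner_comm x y, real_inner_comm] at this
  set d : ℝ := inner ℝ y x with hd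
  have h2 : -(‖x‖ * ‖y‖ * (d - ‖y‖ * ‖x‖) ^ 2) ≥ 0 := by
    nlinarith [this]
  have h3 : (d - ‖y‖ * ‖x‖) ^ 2 ≤ 0 := by
    by_contra! h3
    have := mul_pos (mul_pos hx' hy') h3
    linarith
  have := pow_eq_zero_iff (two_ne_zero) |>.1 (h3.antisymm (sq_nonneg _))
  linarith

lemma exists_eq_add_smul_of_inner_eq {x y c : E} (hxy : x ≠ y)
    (h : (inner ℝ (y - c) (x - c) : ℝ) = ‖y - c‖ * ‖x - c‖) : ∃ t : ℝ, c = x + t • (y - x) := by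
  have hs : ‖x - c‖ • (y - c) = ‖y - c‖ • (x - c) := inner_eq_norm_mul_iff_real.1 h
  set r := ‖x - c‖
  set q := ‖y - c‖
  have hrq : r ≠ q := by
    intro hrq
    rw [hrq] at hs
    rcases eq_or_ne q 0 with hq | hq
    · have h1 : x - c = 0 := norm_eq_zero.1 (hrq.trans hq)
      have h2 : y - c = 0 := norm_eq_zero.1 hq
      exact hxy ((sub_eq_zero.1 h1).trans (sub_eq_zero.1 h2).symm)
    · have := smul_right_injective E hq hs
      exact hxy (sub_left_injective this).symm
  have h0 : r - q ≠ 0 := sub_ne_zero.2 hrq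
  refine ⟨r / (r - q), ?_⟩
  have h1 : (r - q) • c = r • y - q • x := by
    have : r • y - r • c = q • x - q • c := by rw [← smul_sub, ← smul_sub, hs]
    rw [sub_smul, sub_eq_sub_iff_add_eq_add]
    rw [sub_eq_sub_iff_add_eq_add] at this
    rw [add_comm, ← this, add_comm]
  apply smul_right_injective E h0
  simp only
  rw [h1, smul_add, smul_smul, mul_div_cancel₀ _ h0]
  module

variable [MeasurableSpace E]

/-- Almost every pair lies on a common ray from `c`. -/
def Radial (π : Measure (E × E)) (c : E) : Prop :=
  ∀ᵐ z ∂π, (inner ℝ (z.2 - c) (z.1 - c) : ℝ) = ‖z.2 - c‖ * ‖z.1 - c‖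

variable [BorelSpace E] [FiniteDimensional ℝ E]

lemma center_unique {p : ℝ} (hp : 0 < p) (hdim : 2 ≤ Module.finrank ℝ E) {μ : Measure (E × E)}
    (hac : μ.map Prod.fst ≪ volume) (hcost : tCost p μ ≠ 0) {c c' : E} (h : Radial μ c)
    (h' : Radial μ c') : c = c' := by
  by_contra hne
  have hL := Measure.addHaar_affineSubspace (volume : Measure E)
    (AffineSubspace.mk' c (ℝ ∙ (c' - c))) (fun htop => by
      have h1 := congrArg AffineSubspace.direction htop
      rw [AffineSubspace.direction_mk', AffineSubspace.direction_top] at h1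
      have h2 := finrank_span_singleton (K := ℝ) (sub_ne_zero.2 (Ne.symm hne))
      rw [h1, finrank_top] at h2
      omega)
  have hae : ∀ᵐ x : E, x ∉ AffineSubspace.mk' c (ℝ ∙ (c' - c)) := by
    rw [ae_iff]
    simp only [not_not]
    exact hL
  have hae' : ∀ᵐ z ∂μ, z.1 ∉ AffineSubspace.mk' c (ℝ ∙ (c' - c)) :=
    ae_of_ae_map measurable_fst.aemeasurable (hac.ae_le hae)
  refine hcost ?_
  rw [tCost, lintegral_eq_zero_iff (measurable_tCost_integrand p)]
  filter_upwards [h, h', hae'] with z h1 h2 h3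
  by_cases hz : z.1 = z.2
  · simp [hz, Real.zero_rpow hp.ne']
  exfalso
  obtain ⟨t, ht⟩ := exists_eq_add_smul_of_inner_eq hz h1
  obtain ⟨t', ht'⟩ := exists_eq_add_smul_of_inner_eq hz h2
  have htt : t' - t ≠ 0 := by
    intro h0
    rw [sub_eq_zero.1 h0] at ht'
    exact hne (ht.trans ht'.symm)
  apply h3
  rw [AffineSubspace.mem_mk', Submodule.mem_span_singleton]
  refine ⟨-t / (t' - t), ?_⟩
  have e1 : c' - c = (t' - t) • (z.2 - z.1) := by
    rw [ht', ht]; module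
  rw [e1, smul_smul, div_mul_cancel₀ _ htt, vsub_eq_sub]
  conv_rhs => rw [ht]
  module

variable {ρ : E → ℝ} {p : ℝ} {π : Measure (E × E)}

lemma radial_of_symmetric (hp : 1 < p) (hmax : IsMaxDensity p ρ) (hopt : IsOptPlan p ρ π) {a : E}
    (hsymm : ∀ x, ρ ((2 : ℝ) • a - x) = ρ x) : Radial π a := by
  have key : ∀ᵐ z ∂π, ∀ n : ℕ, 0 ≤ (inner ℝ (TopologicalSpace.denseSeq E n) (z.1 - a) : ℝ) *
      inner ℝ (TopologicalSpace.denseSeq E n) (z.2 - a) := by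
    refine ae_all_iff.2 fun n => ?_
    set w := TopologicalSpace.denseSeq E n
    rcases eq_or_ne w 0 with hw | hw
    · simp [hw]
    have hw' := norm_pos_iff.2 hw
    have hv : ‖‖w‖⁻¹ • w‖ = 1 := norm_smul_inv_norm hw
    filter_upwards [no_crossing hp hv hmax (bisects_of_symmetric hv hmax.1 hsymm) hopt] with z hz
    simp only [hlevel, ← inner_sub_right] at hz
    rw [inner_smul_left, inner_smul_left] at hz
    simp only [RCLike.conj_to_real] at hz
    have h2 : 0 ≤ (‖w‖⁻¹ * ‖w‖⁻¹) * ((inner ℝ w (z.1 - a) : ℝ) * inner ℝ w (z.2 - a)) := by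
      linarith
    exact nonneg_of_mul_nonneg_right h2 (by positivity)
  filter_upwards [key] with z hz
  refine inner_eq_norm_mul_of_forall fun w => ?_
  have hcl : IsClosed {w : E | 0 ≤ (inner ℝ w (z.1 - a) : ℝ) * inner ℝ w (z.2 - a)} :=
    isClosed_le continuous_const (by fun_prop)
  have hd : closure (range (TopologicalSpace.denseSeq E)) = univ :=
    (TopologicalSpace.denseRange_denseSeq E).closure_range
  exact hcl.closure_subset_iff.2 (range_subset_iff.2 hz) (hd ▸ mem_univ w)

end Radial

section Orthogonal

variable {E : Type*} [NormedAddCommGroup E] [InnerProductSpace ℝ E] {v w : E}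

lemma hlevel_hrefl_of_inner_eq_zero (h : (inner ℝ w v : ℝ) = 0) (c d : ℝ) (x : E) :
    hlevel w d (hrefl v c x) = hlevel w d x := by
  simp [hlevel, hrefl, inner_sub_right, inner_smul_right, h]

lemma hfold_hrefl_comm (h : (inner ℝ w v : ℝ) = 0) (c d : ℝ) (x : E) :
    hfold w d (hrefl v c x) = hrefl v c (hfold w d x) := by
  have h' : (inner ℝ v w : ℝ) = 0 := by rw [real_inner_comm]; exact h
  have e : hrefl w d (hrefl v c x) = hrefl v c (hrefl w d x) := by
    simp only [hrefl, hlevel, inner_sub_right, inner_smul_right, h, h']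
    module
  unfold hfold
  rw [hlevel_hrefl_of_inner_eq_zero h]
  split_ifs
  · rfl
  · exact e

end Orthogonal

section Coordinates

variable {N : ℕ}

/-- The `i`-th coordinate vector. -/
def coordVec (i : Fin N) : Euc N := EuclideanSpace.single i 1

lemma norm_coordVec (i : Fin N) : ‖coordVec i‖ = 1 := by simp [coordVec]

lemma inner_coordVec (i : Fin N) (x : Euc N) : (inner ℝ (coordVec i) x : ℝ) = x i := by
  simp [coordVec, EuclideanSpace.inner_single_left]

lemma inner_coordVec_of_ne {i j : Fin N} (h : i ≠ j) :
    (inner ℝ (coordVec i) (coordVec j) : ℝ) = 0 := by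
  rw [inner_coordVec]; simp [coordVec, h]

lemma hrefl_coordVec_apply (i j : Fin N) (c : ℝ) (x : Euc N) :
    hrefl (coordVec i) c x j = if j = i then 2 * c - x j else x j := by
  by_cases h : j = i
  · subst h
    rw [hrefl, hlevel, inner_coordVec]
    simp [coordVec]
    ring
  · simp [hrefl, coordVec, h]

lemma symmetric_of_coordinates {ρ : Euc N → ℝ} {a : Euc N}
    (h : ∀ i x, ρ (hrefl (coordVec i) (a i) x) = ρ x) (x : Euc N) :
    ρ ((2 : ℝ) • a - x) = ρ x := by
  have key : ∀ T : Finset (Fin N),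
      ρ (WithLp.toLp 2 fun i => if i ∈ T then 2 * a i - x i else x i) = ρ x := by
    intro T
    induction T using Finset.induction with
    | empty => simp
    | insert i T hi ih =>
      rw [← ih, ← h i (WithLp.toLp 2 fun i => if i ∈ T then 2 * a i - x i else x i)]
      congr 1
      ext j
      rw [hrefl_coordVec_apply]
      by_cases hj : j = i
      · subst hj; simp [hi]
      · simp [hj]
  convert key Finset.univ using 2
  ext i
  simp

variable {ρ : Euc N → ℝ} {p : ℝ} {π : Measure (Euc N × Euc N)}

/-- Reflection symmetry in the coordinate hyperplanes through `a` with directions in `S`. -/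
def SymmOn (S : Finset (Fin N)) (a : Euc N) (ρ : Euc N → ℝ) : Prop :=
  ∀ i ∈ S, ∀ x, ρ (hrefl (coordVec i) (a i) x) = ρ x

/-- Every optimal plan of a maximizer with the symmetries `S` is radial, about a center on the
hyperplanes of symmetry. -/
def RadialOfSymm (p : ℝ) (S : Finset (Fin N)) : Prop :=
  ∀ (ρ : Euc N → ℝ) (π : Measure (Euc N × Euc N)) (a : Euc N), IsMaxDensity p ρ →
    IsOptPlan p ρ π → SymmOn S a ρ → ∃ c : Euc N, (∀ i ∈ S, c i = a i) ∧ Radial π c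

lemma symmOn_comp_hfold {S : Finset (Fin N)} {a : Euc N} (hS : SymmOn S a ρ) {j : Fin N}
    {t : ℝ} {w : Euc N} {d : ℝ} (hw : ‖w‖ = 1)
    (hperp : ∀ i ≠ j, inner ℝ w (coordVec i) = (0 : ℝ))
    (hrefl_eq : hrefl w d = hrefl (coordVec j) t) :
    SymmOn (insert j S) (WithLp.toLp 2 (Function.update a j t)) (ρ ∘ hfold w d) := by
  intro i hi x
  simp only [Function.comp]
  by_cases hij : i = j
  · subst hij
    rw [Function.update_self, ← hrefl_eq, hfold_hrefl hw]
  · rw [Function.update_of_ne hij, hfold_hrefl_comm (hperp i hij)]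
    exact hS i (Finset.mem_of_mem_insert_of_ne hi hij) _

/-- `(w, d)` describes one of the two sides of the hyperplane `x j = t`. -/
def IsSide (j : Fin N) (t : ℝ) (w : Euc N) (d : ℝ) : Prop :=
  (w = coordVec j ∧ d = t) ∨ (w = -coordVec j ∧ d = -t)

lemma half_radial (hp : 1 < p) {S : Finset (Fin N)} {a : Euc N} {j : Fin N} (hj : j ∉ S)
    (ih : RadialOfSymm p (insert j S)) (hmax : IsMaxDensity p ρ) (hopt : IsOptPlan p ρ π)
    (hS : SymmOn S a ρ) {t : ℝ} (ht : Bisects (coordVec j) t ρ) {w : Euc N} {d : ℝ}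
    (hside : IsSide j t w d) :
    ∃ c : Euc N, (∀ i ∈ S, c i = a i) ∧ c j = t ∧
      Radial (π.restrict {z | 0 < hlevel w d z.1}) c ∧
      2 * tCost p (π.restrict {z | 0 < hlevel w d z.1}) = planE p ρ := by
  obtain ⟨hw, hb, hperp, hr⟩ : ‖w‖ = 1 ∧ Bisects w d ρ ∧
      (∀ i ≠ j, inner ℝ w (coordVec i) = (0 : ℝ)) ∧ hrefl w d = hrefl (coordVec j) t := by
    rcases hside with ⟨rfl, rfl⟩ | ⟨rfl, rfl⟩
    · exact ⟨norm_coordVec j, ht, fun i hi => inner_coordVec_of_ne hi.symm, rfl⟩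
    · exact ⟨by rw [norm_neg, norm_coordVec], bisects_neg (norm_coordVec j) hmax.1 ht,
        fun i hi => by rw [inner_neg_left, inner_coordVec_of_ne hi.symm, neg_zero], hrefl_neg _ _⟩
  obtain ⟨hmax', hopt'⟩ := fold_maximizer hp hw hmax hb hopt
  obtain ⟨-, he, -⟩ := exists_same_side_optPlan hp hw hmax hb
  obtain ⟨c, hc, hrad⟩ := ih _ _ _ hmax' hopt' (symmOn_comp_hfold hS hw hperp hr)
  refine ⟨c, fun i hi => ?_, ?_, (ae_add_measure_iff.1 hrad).1, ?_⟩
  · have hij : i ≠ j := fun h => hj (h ▸ hi)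
    rw [hc i (Finset.mem_insert_of_mem hi)]
    simp [hij]
  · rw [hc j (Finset.mem_insert_self _ _)]
    simp
  · rw [← tCost_planDouble hw, hopt'.2, he]

lemma radialOfSymm_of_insert (hp : 1 < p) {S : Finset (Fin N)} (hne : S ≠ Finset.univ)
    (ih : ∀ j ∉ S, RadialOfSymm p (insert j S)) : RadialOfSymm p S := by
  intro ρ π a hmax hopt hS
  have hp0 : 0 < p := by linarith
  by_cases h0 : planE p ρ = 0
  · refine ⟨a, fun _ _ => rfl, ?_⟩
    have h := hopt.2.trans h0
    rw [tCost, lintegral_eq_zero_iff (measurable_tCost_integrand p)] at h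
    filter_upwards [h] with z hz
    have h1 : dist z.1 z.2 ^ p ≤ 0 := ENNReal.ofReal_eq_zero.1 hz
    have h2 : dist z.1 z.2 = 0 := by
      by_contra hd
      exact absurd (Real.rpow_pos_of_pos (lt_of_le_of_ne dist_nonneg (Ne.symm hd)) p) h1.not_gt
    rw [dist_eq_zero.1 h2, real_inner_self_eq_norm_mul_norm]
  choose t ht using fun j => exists_bisects (norm_coordVec j) hmax.1
  have hae : ∀ j, ∀ᵐ z ∂π, hlevel (coordVec j) (t j) z.1 ≠ 0 := fun j =>
    ae_fst_of_AP hopt.1 (hlevel_ae_ne (norm_coordVec j) _)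
  have hac : π.map Prod.fst ≪ volume := by rw [hopt.1.1]; exact densM_ac ρ
  obtain ⟨j₀, hj₀⟩ : ∃ j, j ∉ S := by
    by_contra! h
    exact hne (Finset.eq_univ_iff_forall.2 h)
  have center : ∀ {w d c}, IsSide j₀ (t j₀) w d →
      Radial (π.restrict {z | 0 < hlevel w d z.1}) c →
      2 * tCost p (π.restrict {z | 0 < hlevel w d z.1}) = planE p ρ →
      ∀ j ∉ S, j ≠ j₀ → c j = t j := by
    intro w d c hside hrad hcost j hj hjj
    set μ := π.restrict {z | 0 < hlevel w d z.1} with hμ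
    have hdim : 2 ≤ Module.finrank ℝ (Euc N) := by
      rw [finrank_euclideanSpace_fin]
      have := Fintype.one_lt_card_iff.2 ⟨j, j₀, hjj⟩
      rwa [Fintype.card_fin] at this
    have hμ0 : tCost p μ ≠ 0 := fun h => h0 (by rw [← hcost, h, mul_zero])
    have hsum := restrict_add_restrict_hlevel (μ := μ) measurable_fst (ae_restrict_of_ae (hae j))
    have hex : ∃ w' d', IsSide j (t j) w' d' ∧
        tCost p (μ.restrict {z | 0 < hlevel w' d' z.1}) ≠ 0 := by
      by_contra! hcon
      refine hμ0 ?_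
      rw [← hsum, tCost_add, hcon _ _ (Or.inl ⟨rfl, rfl⟩), hcon _ _ (Or.inr ⟨rfl, rfl⟩), add_zero]
    obtain ⟨w', d', hside', hne'⟩ := hex
    obtain ⟨c', -, hc', hrad', -⟩ := half_radial hp hj (ih j hj) hmax hopt hS (ht j) hside'
    have hcc : c = c' := by
      refine center_unique hp0 hdim ?_ hne' (ae_restrict_of_ae hrad) ?_
      · exact (Measure.absolutelyContinuous_of_le (Measure.map_mono
          (Measure.restrict_le_self.trans Measure.restrict_le_self) measurable_fst)).trans hac
      · refine Measure.absolutelyContinuous_of_le ?_ |>.ae_le hrad'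
        exact Measure.restrict_mono le_rfl Measure.restrict_le_self
    rw [hcc, hc']
  obtain ⟨c₁, h₁S, h₁j, h₁r, h₁c⟩ := half_radial hp hj₀ (ih j₀ hj₀) hmax hopt hS (ht j₀)
    (Or.inl ⟨rfl, rfl⟩)
  obtain ⟨c₂, h₂S, h₂j, h₂r, h₂c⟩ := half_radial hp hj₀ (ih j₀ hj₀) hmax hopt hS (ht j₀)
    (Or.inr ⟨rfl, rfl⟩)
  have hcc : c₁ = c₂ := by
    ext j
    by_cases hj : j ∈ S
    · rw [h₁S j hj, h₂S j hj]
    by_cases hjj : j = j₀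
    · rw [hjj, h₁j, h₂j]
    · rw [center (Or.inl ⟨rfl, rfl⟩) h₁r h₁c j hj hjj, center (Or.inr ⟨rfl, rfl⟩) h₂r h₂c j hj hjj]
  refine ⟨c₁, h₁S, ?_⟩
  rw [Radial, ← restrict_add_restrict_hlevel measurable_fst (hae j₀)]
  exact ae_add_measure_iff.2 ⟨h₁r, hcc ▸ h₂r⟩

lemma radialOfSymm (hp : 1 < p) (S : Finset (Fin N)) : RadialOfSymm p S := by
  induction h : Sᶜ.card using Nat.strong_induction_on generalizing S with
  | _ n ih =>
    by_cases hS : S = Finset.univ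
    · intro ρ π a hmax hopt hsymm
      refine ⟨a, fun _ _ => rfl, radial_of_symmetric hp hmax hopt ?_⟩
      exact symmetric_of_coordinates fun i => hsymm i (hS ▸ Finset.mem_univ i)
    · refine radialOfSymm_of_insert hp hS fun j hj => ih _ ?_ _ rfl
      rw [← h]
      refine Finset.card_lt_card (Finset.compl_ssubset_compl.2 (Finset.ssubset_insert hj))

end Coordinates

/-- If `ρ` is a maximizer of `𝒲_p` over `A`, then the optimal plan `π_ρ` is radial
with respect to some center `x₀`: `π_ρ`-a.e. pair `(x,y)` lies on a common ray from `x₀`. -/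
theorem maximizer_radial_plan {N : ℕ} (p : ℝ) (hp : 1 < p)
    (ρ : Euc N → ℝ) (hρ : memA volume 1 ρ)
    (hmax : ∀ σ : Euc N → ℝ, memA volume 1 σ → WEnergy p volume σ ≤ WEnergy p volume ρ)
    (η : Euc N → ℝ) (hη : Adm volume ρ η)
    (hη_opt : WpPow p (densM volume ρ) (densM volume η) = WEnergyPow p volume ρ)
    (π : Measure (Euc N × Euc N)) (hπ : IsCoupling π (densM volume ρ) (densM volume η))
    (hπ_opt : tCost p π = WpPow p (densM volume ρ) (densM volume η)) :
    ∃ x₀ : Euc N,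
      π {z : Euc N × Euc N |
          (inner ℝ (z.2 - x₀) (z.1 - x₀) : ℝ) ≠ ‖z.2 - x₀‖ * ‖z.1 - x₀‖} = 0 := by
  have hmax' : IsMaxDensity p ρ := by
    refine ⟨hρ, fun σ hσ => ?_⟩
    have := hmax σ hσ
    rwa [WEnergy, WEnergy, ENNReal.rpow_le_rpow_iff (by positivity), WEnergyPow_eq_planE p hσ,
      WEnergyPow_eq_planE p hρ] at this
  have hopt : IsOptPlan p ρ π := by
    refine ⟨⟨hπ.1, ?_⟩, by rw [hπ_opt, hη_opt, WEnergyPow_eq_planE p hρ]⟩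
    rw [hπ.2]
    refine withDensity_mono ?_
    filter_upwards [hη.2.2.1] with x hx
    exact ENNReal.ofReal_le_ofReal (by linarith)
  obtain ⟨c, -, hc⟩ := radialOfSymm hp ∅ ρ π 0 hmax' hopt (by simp [SymmOn])
  exact ⟨c, ae_iff.1 hc⟩
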